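/- Let n ≥ 1 and let p⃗, s⃗ be n-tuples with 1 ≤ pᵢ, sᵢ < ∞, with conjugate tuples p⃗′, s⃗′. Then the dual of (L^{p⃗},ℓ^{s⃗})(ℝⁿ) is isometrically isomorphic to (L^{p⃗′},ℓ^{s⃗′})(ℝⁿ): for every bounded linear functional T on (L^{p⃗},ℓ^{s⃗})(ℝⁿ) there is a unique g ∈ (L^{p⃗′},ℓ^{s⃗′})(ℝⁿ) with T(f) = ∫_{ℝⁿ} f(x)g(x) dx for all f ∈ (L^{p⃗},ℓ^{s⃗})(ℝⁿ) and ‖g‖_{p⃗′,s⃗′} = ‖T‖; conversely, every g ∈ (L^{p⃗′},ℓ^{s⃗′})(ℝⁿ) defines such a bounded functional. -/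

import Mathlib

open MeasureTheory ENNReal Filter Topology Set

noncomputable section

namespace MixedAmalgam

/-- `L^p` norm over `ℝ` of an `ℝ≥0∞`-valued function, with the usual
modification (`essSup`) for `p = ∞`. -/
def lpInt (p : ℝ≥0∞) (g : ℝ → ℝ≥0∞) : ℝ≥0∞ :=
  if p = ∞ then essSup g volume else (∫⁻ t, g t ^ p.toReal) ^ (1 / p.toReal)

/-- `ℓ^p` norm over `ℤ` of an `ℝ≥0∞`-valued family, with the usual
modification for `p = ∞`. -/
def lpSum (p : ℝ≥0∞) (g : ℤ → ℝ≥0∞) : ℝ≥0∞ :=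
  if p = ∞ then ⨆ k, g k else (∑' k, g k ^ p.toReal) ^ (1 / p.toReal)

/-- Iterated mixed Lebesgue norm of an `ℝ≥0∞`-valued function on `ℝⁿ`,
taking the `L^{p₁}` norm in the first variable innermost, and the `L^{pₙ}`
norm in the last variable outermost. -/
def mixedE : (n : ℕ) → (Fin n → ℝ≥0∞) → ((Fin n → ℝ) → ℝ≥0∞) → ℝ≥0∞
  | 0, _, g => g Fin.elim0
  | n + 1, p, g =>
    lpInt (p (Fin.last n)) fun t =>
      mixedE n (fun i => p i.castSucc) fun x => g (Fin.snoc x t)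

/-- Mixed-norm Lebesgue norm `‖f‖_{L^{p⃗}}` of a real-valued function on `ℝⁿ`. -/
def mixedLp (n : ℕ) (p : Fin n → ℝ≥0∞) (f : (Fin n → ℝ) → ℝ) : ℝ≥0∞ :=
  mixedE n p fun x => (‖f x‖₊ : ℝ≥0∞)

/-- Iterated mixed `ℓ^{s⃗}` norm of an `ℝ≥0∞`-valued family indexed by `ℤⁿ`. -/
def mixedSeq : (n : ℕ) → (Fin n → ℝ≥0∞) → ((Fin n → ℤ) → ℝ≥0∞) → ℝ≥0∞
  | 0, _, a => a Fin.elim0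
  | n + 1, s, a =>
    lpSum (s (Fin.last n)) fun k =>
      mixedSeq n (fun i => s i.castSucc) fun m => a (Fin.snoc m k)

/-- Open Euclidean ball of center `y` and radius `r` in `ℝⁿ`. -/
def eball (n : ℕ) (y : Fin n → ℝ) (r : ℝ) : Set (Fin n → ℝ) :=
  {x | Real.sqrt (∑ i, (x i - y i) ^ 2) < r}

/-- `Σᵢ 1/pᵢ` as a real number. -/
def invSum (n : ℕ) (p : Fin n → ℝ≥0∞) : ℝ :=
  ∑ i, (1 / p i).toReal

/-- The `(L^{p⃗},L^{s⃗})` amalgam norm computed with balls of radius `r`. -/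
def amalgamNormR (n : ℕ) (p s : Fin n → ℝ≥0∞) (r : ℝ) (f : (Fin n → ℝ) → ℝ) : ℝ≥0∞ :=
  mixedE n s fun y => mixedLp n p ((eball n y r).indicator f)

/-- The amalgam norm `‖f‖_{(L^{p⃗},L^{s⃗})}`. -/
def amalgamNorm (n : ℕ) (p s : Fin n → ℝ≥0∞) (f : (Fin n → ℝ) → ℝ) : ℝ≥0∞ :=
  amalgamNormR n p s 1 f

/-- The amalgam norm `‖f‖_{(L^{p⃗},L^{s⃗})^α}`. -/
def amalgamNormA (n : ℕ) (p s : Fin n → ℝ≥0∞) (α : ℝ≥0∞) (f : (Fin n → ℝ) → ℝ) : ℝ≥0∞ :=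
  ⨆ (r : ℝ) (_ : 0 < r),
    mixedE n s fun y =>
      volume (eball n y r) ^
          ((1 / α).toReal - invSum n p / (n : ℝ) - invSum n s / (n : ℝ)) *
        mixedLp n p ((eball n y r).indicator f)

/-- The amalgam norm `‖·‖_{(L^{p⃗},L^{s⃗})^α}` for `ℝ≥0∞`-valued functions. -/
def amalgamNormAE (n : ℕ) (p s : Fin n → ℝ≥0∞) (α : ℝ≥0∞)
    (g : (Fin n → ℝ) → ℝ≥0∞) : ℝ≥0∞ :=
  ⨆ (r : ℝ) (_ : 0 < r),
    mixedE n s fun y =>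
      volume (eball n y r) ^
          ((1 / α).toReal - invSum n p / (n : ℝ) - invSum n s / (n : ℝ)) *
        mixedE n p ((eball n y r).indicator g)

/-- The cube `Q_{r,k} = r(k + [0,1)ⁿ)`. -/
def qcube (n : ℕ) (r : ℝ) (k : Fin n → ℤ) : Set (Fin n → ℝ) :=
  {x | ∀ i, r * (k i : ℝ) ≤ x i ∧ x i < r * ((k i : ℝ) + 1)}

/-- The discrete amalgam norm `_r‖f‖_{p⃗,s⃗}`. -/
def discNormR (n : ℕ) (p s : Fin n → ℝ≥0∞) (r : ℝ) (f : (Fin n → ℝ) → ℝ) : ℝ≥0∞ :=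
  mixedSeq n s fun k => mixedLp n p ((qcube n r k).indicator f)

/-- The discrete amalgam norm `‖f‖_{p⃗,s⃗} = _1‖f‖_{p⃗,s⃗}`. -/
def discNorm (n : ℕ) (p s : Fin n → ℝ≥0∞) (f : (Fin n → ℝ) → ℝ) : ℝ≥0∞ :=
  discNormR n p s 1 f

/-- The discrete amalgam norm
`‖f‖_{p⃗,s⃗,α} = sup_{r>0} r^{n/α - Σᵢ 1/pᵢ} · _r‖f‖_{p⃗,s⃗}`. -/
def discNormA (n : ℕ) (p s : Fin n → ℝ≥0∞) (α : ℝ≥0∞) (f : (Fin n → ℝ) → ℝ) : ℝ≥0∞ :=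
  ⨆ (r : ℝ) (_ : 0 < r),
    ENNReal.ofReal (r ^ ((n : ℝ) * (1 / α).toReal - invSum n p)) * discNormR n p s r f

/-- Membership in `(L^{p⃗},L^{s⃗})^α(ℝⁿ)` (continuous form). -/
def memA (n : ℕ) (p s : Fin n → ℝ≥0∞) (α : ℝ≥0∞) (f : (Fin n → ℝ) → ℝ) : Prop :=
  LocallyIntegrable f volume ∧ amalgamNormA n p s α f < ∞

/-- Membership in `(L^{p⃗},ℓ^{s⃗})(ℝⁿ)`. -/
def memD (n : ℕ) (p s : Fin n → ℝ≥0∞) (f : (Fin n → ℝ) → ℝ) : Prop :=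
  LocallyIntegrable f volume ∧ discNorm n p s f < ∞

/-- Membership in `(L^{p⃗},ℓ^{s⃗})^α(ℝⁿ)`. -/
def memDA (n : ℕ) (p s : Fin n → ℝ≥0∞) (α : ℝ≥0∞) (f : (Fin n → ℝ) → ℝ) : Prop :=
  LocallyIntegrable f volume ∧ discNormA n p s α f < ∞

/-- The dilation `St_r^{(α)} f = r^{-n/α} f(r⁻¹ ·)`. -/
def dil (n : ℕ) (α : ℝ≥0∞) (r : ℝ) (f : (Fin n → ℝ) → ℝ) : (Fin n → ℝ) → ℝ :=
  fun x => r ^ (-((n : ℝ) * (1 / α).toReal)) * f (r⁻¹ • x)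

/-- A block decomposition `f = Σ_j c_j St_{r_j}^{(α')} f_j` converging in `L¹_loc`. -/
structure BlockDecomp (n : ℕ) (p' s' : Fin n → ℝ≥0∞) (α' : ℝ≥0∞) (f : (Fin n → ℝ) → ℝ)
    (c : ℕ → ℝ) (rr : ℕ → ℝ) (g : ℕ → (Fin n → ℝ) → ℝ) : Prop where
  csummable : Summable fun j => |c j|
  rpos : ∀ j, 0 < rr j
  gloc : ∀ j, LocallyIntegrable (g j) volume
  gnorm : ∀ j, discNorm n p' s' (g j) ≤ 1
  conv : ∀ K : Set (Fin n → ℝ), IsCompact K →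
    Tendsto (fun J : ℕ =>
        ∫⁻ x in K,
          (‖f x - ∑ j ∈ Finset.range J, c j * dil n α' (rr j) (g j) x‖₊ : ℝ≥0∞))
      atTop (𝓝 0)

/-- Membership in the block space `H(p⃗',s⃗',α')`. -/
def memH (n : ℕ) (p' s' : Fin n → ℝ≥0∞) (α' : ℝ≥0∞) (f : (Fin n → ℝ) → ℝ) : Prop :=
  LocallyIntegrable f volume ∧ ∃ c rr g, BlockDecomp n p' s' α' f c rr g

/-- The norm of the block space `H(p⃗',s⃗',α')`. -/
def hNorm (n : ℕ) (p' s' : Fin n → ℝ≥0∞) (α' : ℝ≥0∞) (f : (Fin n → ℝ) → ℝ) : ℝ≥0∞ :=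
  ⨅ (c : ℕ → ℝ) (rr : ℕ → ℝ) (g : ℕ → (Fin n → ℝ) → ℝ)
    (_ : BlockDecomp n p' s' α' f c rr g), ENNReal.ofReal (∑' j, |c j|)

/-- The fractional integral operator `I_γ`. -/
def fracInt (n : ℕ) (γ : ℝ) (f : (Fin n → ℝ) → ℝ) : (Fin n → ℝ) → ℝ :=
  fun x => ∫ y, f y / Real.sqrt (∑ i, (x i - y i) ^ 2) ^ ((n : ℝ) - γ)

/-- The fractional maximal operator `M_γ`. -/
def fracMax (n : ℕ) (γ : ℝ) (f : (Fin n → ℝ) → ℝ) : (Fin n → ℝ) → ℝ≥0∞ :=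
  fun x => ⨆ (y : Fin n → ℝ) (r : ℝ) (_ : 0 < r) (_ : x ∈ eball n y r),
    volume (eball n y r) ^ (γ / (n : ℝ) - 1) * ∫⁻ z in eball n y r, (‖f z‖₊ : ℝ≥0∞)

/-- The commutator `[b, I_γ] f`. -/
def commFracInt (n : ℕ) (γ : ℝ) (b f : (Fin n → ℝ) → ℝ) : (Fin n → ℝ) → ℝ :=
  fun x => ∫ y, (b x - b y) * f y / Real.sqrt (∑ i, (x i - y i) ^ 2) ^ ((n : ℝ) - γ)

/-- The mean value `b_B` of `b` over the ball `B(y,r)`. -/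
def ballAvg (n : ℕ) (b : (Fin n → ℝ) → ℝ) (y : Fin n → ℝ) (r : ℝ) : ℝ :=
  (volume (eball n y r)).toReal⁻¹ * ∫ x in eball n y r, b x

/-- The `BMO` norm `sup_B (1/|B|) ∫_B |b - b_B|`. -/
def bmoNorm (n : ℕ) (b : (Fin n → ℝ) → ℝ) : ℝ≥0∞ :=
  ⨆ (y : Fin n → ℝ) (r : ℝ) (_ : 0 < r),
    ENNReal.ofReal
      ((volume (eball n y r)).toReal⁻¹ * ∫ x in eball n y r, |b x - ballAvg n b y r|)


section Helpers

open Function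

/-- generic `L^p` norm. -/
def LN {X : Type} [MeasurableSpace X] (p : ℝ≥0∞) (μ : Measure X) (g : X → ℝ≥0∞) : ℝ≥0∞ :=
  if p = ∞ then essSup g μ else (∫⁻ t, g t ^ p.toReal ∂μ) ^ (1 / p.toReal)

structure Nm {X : Type} [MeasurableSpace X] (μ : Measure X)
    (N : (X → ℝ≥0∞) → ℝ≥0∞) : Prop where
  meas : ∀ {Z : Type} [MeasurableSpace Z] (g : Z → X → ℝ≥0∞), Measurable (uncurry g) →
    Measurable fun z => N (g z)
  smul : ∀ (c : ℝ≥0∞) (g : X → ℝ≥0∞), Measurable g → N (fun x => c * g x) = c * N g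
  mono : ∀ (f g : X → ℝ≥0∞), f ≤ᵐ[μ] g → N f ≤ N g

structure Fc {X : Type} [MeasurableSpace X] (μ : Measure X)
    (N : (X → ℝ≥0∞) → ℝ≥0∞) : Prop where
  fin : ∀ h : X → ℝ≥0∞, Measurable h → N h < ∞ → ∀ᵐ x ∂μ, h x < ∞
  oc : ∀ (f : ℕ → X → ℝ≥0∞) (F : X → ℝ≥0∞), (∀ m, Measurable (f m)) → Measurable F →
    N F < ∞ → (∀ᵐ x ∂μ, ∀ m, f m x ≤ F x) →
    (∀ᵐ x ∂μ, Tendsto (fun m => f m x) atTop (𝓝 0)) →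
    Tendsto (fun m => N (f m)) atTop (𝓝 0)
  pos : ∃ w : X → ℝ≥0∞, Measurable w ∧ (∀ x, 0 < w x) ∧ (∀ x, w x ≤ 1) ∧ N w < ∞

structure Du {X : Type} [MeasurableSpace X] (μ : Measure X)
    (N N' : (X → ℝ≥0∞) → ℝ≥0∞) : Prop where
  holder : ∀ f g : X → ℝ≥0∞, Measurable f → Measurable g →
    ∫⁻ x, f x * g x ∂μ ≤ N f * N' g
  ext : ∀ {Z : Type} [MeasurableSpace Z] (g : Z → X → ℝ≥0∞), Measurable (uncurry g) →
    ∃ f : ℕ → Z → X → ℝ≥0∞, (∀ j, Measurable (uncurry (f j))) ∧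
      (∀ j z, N (f j z) ≤ 1) ∧
      ∀ z, N' (g z) ≤ ⨆ j, ∫⁻ x, f j z x * g z x ∂μ

theorem LN_nm {X : Type} [MeasurableSpace X] (μ : Measure X) [SigmaFinite μ] (p : ℝ≥0∞)
    (hp : 1 ≤ p) : Nm μ (LN p μ) := by
  by_cases hpt : p = ∞
  · have e : LN p μ = fun g => essSup g μ := by funext g; simp [LN, hpt]
    rw [e]
    refine ⟨?_, ?_, ?_⟩
    · intro Z _ g hg
      refine measurable_of_Ioi fun a => ?_
      have : (fun z => essSup (g z) μ) ⁻¹' Set.Ioi a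
          = (fun z => μ (Prod.mk z ⁻¹' {q : Z × X | a < uncurry g q})) ⁻¹' {0}ᶜ := by
        ext z
        simp only [Set.mem_preimage, Set.mem_Ioi, Set.mem_compl_iff, Set.mem_singleton_iff]
        rw [← not_le, not_iff_not]
        constructor
        · intro h
          have := ENNReal.ae_le_essSup (μ := μ) (g z)
          rw [measure_eq_zero_iff_ae_notMem]
          filter_upwards [this] with x hx
          simpa using hx.trans h
        · intro h
          rw [measure_eq_zero_iff_ae_notMem] at h
          refine essSup_le_of_ae_le _ ?_
          filter_upwards [h] with x hx
          simpa using hx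
      rw [this]
      exact measurable_measure_prodMk_left (measurableSet_lt measurable_const hg)
        (MeasurableSet.singleton 0).compl
    · intro c g _
      exact ENNReal.essSup_const_mul
    · intro f g h
      exact essSup_mono_ae h
  · have hp0 : 0 < p.toReal := ENNReal.toReal_pos (by rintro rfl; simp at hp) hpt
    have e : LN p μ = fun g => (∫⁻ t, g t ^ p.toReal ∂μ) ^ (1 / p.toReal) := by
      funext g; simp [LN, hpt]
    rw [e]
    refine ⟨?_, ?_, ?_⟩
    · intro Z _ g hg
      exact (Measurable.lintegral_prod_right' (f := fun q : Z × X => uncurry g q ^ p.toReal)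
        (hg.pow_const _)).pow_const _
    · intro c g hg
      simp only [ENNReal.mul_rpow_of_nonneg _ _ hp0.le]
      rw [lintegral_const_mul _ (hg.pow_const _), ENNReal.mul_rpow_of_nonneg _ _ (by positivity),
        ← ENNReal.rpow_mul, mul_one_div_cancel hp0.ne', ENNReal.rpow_one]
    · intro f g h
      apply ENNReal.rpow_le_rpow _ (by positivity)
      apply lintegral_mono_ae
      filter_upwards [h] with x hx
      exact ENNReal.rpow_le_rpow hx hp0.le

theorem LN_fc {X : Type} [MeasurableSpace X] (μ : Measure X) [SigmaFinite μ] (p : ℝ≥0∞)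
    (hp : 1 ≤ p) (hpt : p ≠ ∞) : Fc μ (LN p μ) := by
  have hp1 : 1 ≤ p.toReal := by
    simpa using ENNReal.toReal_mono hpt hp
  have hp0 : 0 < p.toReal := by linarith
  have e : LN p μ = fun g => (∫⁻ t, g t ^ p.toReal ∂μ) ^ (1 / p.toReal) := by
    funext g; simp [LN, hpt]
  rw [e]
  have hlt : ∀ h : X → ℝ≥0∞, (∫⁻ t, h t ^ p.toReal ∂μ) ^ (1 / p.toReal) < ∞ →
      ∫⁻ t, h t ^ p.toReal ∂μ ≠ ∞ := by
    intro h hh h2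
    rw [h2, ENNReal.top_rpow_of_pos (by positivity)] at hh
    exact lt_irrefl _ hh
  refine ⟨?_, ?_, ?_⟩
  · intro h hm hh
    filter_upwards [ae_lt_top (hm.pow_const _) (hlt h hh)] with x hx
    rw [lt_top_iff_ne_top]
    rintro h2
    rw [h2, ENNReal.top_rpow_of_pos hp0] at hx
    exact lt_irrefl _ hx
  · intro f F hf hF hN hle ht
    have := tendsto_lintegral_of_dominated_convergence (μ := μ)
      (F := fun m x => f m x ^ p.toReal) (f := fun _ => 0) (fun x => F x ^ p.toReal)
      (fun m => (hf m).pow_const _) ?_ (hlt F hN) ?_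
    · have h2 := ((ENNReal.continuous_rpow_const (y := 1 / p.toReal)).tendsto _).comp this
      simpa [Function.comp_def, hp0] using h2
    · intro m
      filter_upwards [hle] with x hx
      exact ENNReal.rpow_le_rpow (hx m) hp0.le
    · filter_upwards [ht] with x hx
      have h2 := ((ENNReal.continuous_rpow_const (y := p.toReal)).tendsto _).comp hx
      simpa [Function.comp_def, hp0] using h2
  · obtain ⟨g, g0, gm, hg⟩ := exists_pos_lintegral_lt_of_sigmaFinite μ (ε := 1) one_ne_zero
    refine ⟨fun x => min (g x) 1, by fun_prop, ?_, ?_, ?_⟩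
    · intro x; simp [g0 x]
    · intro x; exact min_le_right _ _
    · apply ENNReal.rpow_lt_top_of_nonneg (by positivity)
      refine ((lintegral_mono fun x => ?_).trans_lt (hg.trans one_lt_top)).ne
      calc (min (g x : ℝ≥0∞) 1) ^ p.toReal ≤ (min (g x : ℝ≥0∞) 1) ^ (1 : ℝ) :=
            ENNReal.rpow_le_rpow_of_exponent_ge (min_le_right _ _) hp1
        _ ≤ g x := by rw [ENNReal.rpow_one]; exact min_le_left _ _

theorem conj_cases (p q : ℝ≥0∞) (hp : 1 ≤ p) (hpt : p ≠ ∞) (h : 1 / p + 1 / q = 1) :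
    (p = 1 ∧ q = ∞) ∨ (q ≠ ∞ ∧ p.toReal.HolderConjugate q.toReal) := by
  have hc : ENNReal.HolderConjugate p q := by
    constructor
    simpa using h
  by_cases hq : q = ∞
  · left
    subst hq
    simp at h
    exact ⟨h, rfl⟩
  · right
    refine ⟨hq, ?_⟩
    have h1 : p ≠ 1 := by
      rintro rfl
      have := ENNReal.HolderConjugate.unique 1 q ∞
      exact hq this
    exact (ENNReal.HolderConjugate.toReal_of_ne_top hpt hq)

theorem one_le_conj (p q : ℝ≥0∞) (h : 1 / p + 1 / q = 1) : 1 ≤ q := by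
  have : 1 / q ≤ 1 := le_add_self.trans_eq h
  simpa using this


theorem LN_du_one {X : Type} [MeasurableSpace X] (μ : Measure X) [SigmaFinite μ] :
    Du μ (LN 1 μ) (LN ∞ μ) := by
  have e1 : LN 1 μ = fun g => ∫⁻ t, g t ∂μ := by
    funext g; simp [LN]
  have e2 : LN ∞ μ = fun g => essSup g μ := by funext g; simp [LN]
  rw [e1, e2]
  refine ⟨?_, ?_⟩
  · intro f g hf hg
    rw [← lintegral_mul_const _ hf]
    apply lintegral_mono_ae
    filter_upwards [ENNReal.ae_le_essSup (μ := μ) g] with x hx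
    gcongr
  · intro Z _ g hg
    obtain ⟨σ, hσ⟩ := exists_surjective_nat (ℚ × ℕ)
    let c : ℕ → ℝ≥0∞ := fun j => ENNReal.ofReal ((σ j).1 : ℝ)
    let E : ℕ → Set (Z × X) := fun j =>
      {q | c j < uncurry g q} ∩ (Prod.snd ⁻¹' spanningSets μ (σ j).2)
    have hE : ∀ j, MeasurableSet (E j) := fun j =>
      (measurableSet_lt measurable_const hg).inter
        (measurable_snd (measurableSet_spanningSets μ _))
    have hEz : ∀ j z, MeasurableSet (Prod.mk z ⁻¹' E j) := fun j z =>
      measurable_prodMk_left (hE j)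
    refine ⟨fun j z x => (E j).indicator 1 (z, x) * (μ (Prod.mk z ⁻¹' E j))⁻¹, ?_, ?_, ?_⟩
    · intro j
      have h1 : Measurable (fun q : Z × X => (E j).indicator (1 : Z × X → ℝ≥0∞) q) :=
        measurable_one.indicator (hE j)
      have h2 : Measurable (fun q : Z × X => (μ (Prod.mk q.1 ⁻¹' E j))⁻¹) :=
        ((measurable_measure_prodMk_left (hE j)).comp measurable_fst).inv
      exact h1.mul h2
    · intro j z
      have : ∀ x, (E j).indicator (1 : Z × X → ℝ≥0∞) (z, x)
          = (Prod.mk z ⁻¹' E j).indicator 1 x := fun x => rfl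
      simp only [this]
      rw [lintegral_mul_const _ (measurable_one.indicator (hEz j z)),
        lintegral_indicator_one (hEz j z)]
      exact ENNReal.mul_inv_le_one _
    · intro z
      refine le_of_forall_lt fun a ha => ?_
      obtain ⟨b, hab, hb⟩ := exists_between ha
      obtain ⟨q, hq0, haq, hqb⟩ := ENNReal.lt_iff_exists_rat_btwn.1 hab
      have hpos : μ {x | ENNReal.ofReal (q : ℝ) < g z x} ≠ 0 := by
        intro h0
        rw [measure_eq_zero_iff_ae_notMem] at h0
        have : essSup (g z) μ ≤ ENNReal.ofReal (q : ℝ) := by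
          refine essSup_le_of_ae_le _ ?_
          filter_upwards [h0] with x hx
          simpa using hx
        exact absurd (this.trans_lt (hqb.trans hb)) (lt_irrefl _)
      have : ∃ i, μ ({x | ENNReal.ofReal (q : ℝ) < g z x} ∩ spanningSets μ i) ≠ 0 := by
        by_contra! hcon
        apply hpos
        have := measure_iUnion_null hcon
        rwa [← Set.inter_iUnion, iUnion_spanningSets, Set.inter_univ] at this
      obtain ⟨i, hi⟩ := this
      obtain ⟨j, hj⟩ := hσ (q, i)
      have hEj : Prod.mk z ⁻¹' E j = {x | ENNReal.ofReal (q : ℝ) < g z x} ∩ spanningSets μ i := by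
        ext x; simp [E, c, hj]
      have hfin : μ (Prod.mk z ⁻¹' E j) ≠ ∞ := by
        rw [hEj]
        exact ((measure_mono Set.inter_subset_right).trans_lt
          (measure_spanningSets_lt_top μ i)).ne
      have hne : μ (Prod.mk z ⁻¹' E j) ≠ 0 := by rw [hEj]; exact hi
      have haq' : a < ENNReal.ofReal (q : ℝ) := haq
      refine haq'.trans_le (le_trans ?_ (le_iSup _ j))
      calc ENNReal.ofReal (q : ℝ)
          = ∫⁻ x, (Prod.mk z ⁻¹' E j).indicator 1 x *
              ((μ (Prod.mk z ⁻¹' E j))⁻¹ * ENNReal.ofReal (q : ℝ)) ∂μ := by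
            rw [lintegral_mul_const _ (measurable_one.indicator (hEz j z)),
              lintegral_indicator_one (hEz j z), ← mul_assoc, ENNReal.mul_inv_cancel hne hfin,
              one_mul]
        _ ≤ _ := by
            apply lintegral_mono
            intro x
            show _ ≤ (Prod.mk z ⁻¹' E j).indicator 1 x * _ * _
            by_cases hx : x ∈ Prod.mk z ⁻¹' E j
            · have hx2 : ENNReal.ofReal (q : ℝ) < g z x := by
                rw [hEj] at hx; exact hx.1
              simp only [Set.indicator_of_mem hx, Pi.one_apply, one_mul]
              gcongr
            · simp [Set.indicator_of_notMem hx]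

theorem LN_du_gt {X : Type} [MeasurableSpace X] (μ : Measure X) [SigmaFinite μ] (p q : ℝ≥0∞)
    (hpt : p ≠ ∞) (hqt : q ≠ ∞) (hpq : p.toReal.HolderConjugate q.toReal) :
    Du μ (LN p μ) (LN q μ) := by
  have e1 : LN p μ = fun g => (∫⁻ t, g t ^ p.toReal ∂μ) ^ (1 / p.toReal) := by
    funext g; simp [LN, hpt]
  have e2 : LN q μ = fun g => (∫⁻ t, g t ^ q.toReal ∂μ) ^ (1 / q.toReal) := by
    funext g; simp [LN, hqt]
  rw [e1, e2]
  generalize p.toReal = P at *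
  generalize q.toReal = Q at *
  have hP := hpq.pos
  have hQ := hpq.symm.pos
  have hQ1 : 0 ≤ Q - 1 := by linarith [hpq.symm.lt]
  refine ⟨?_, ?_⟩
  · intro f g hf hg
    exact ENNReal.lintegral_mul_le_Lp_mul_Lq μ hpq hf.aemeasurable hg.aemeasurable
  · intro Z _ g hg
    let S := fun j => spanningSets μ j
    have hS : ∀ j, MeasurableSet (S j) := measurableSet_spanningSets μ
    let G : ℕ → Z → X → ℝ≥0∞ := fun j z x => (S j).indicator (fun x => min (g z x) j) x
    have hG : ∀ j, Measurable (uncurry (G j)) := by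
      intro j
      have : uncurry (G j) = (Prod.snd ⁻¹' S j).indicator (fun q => min (uncurry g q) j) := by
        ext ⟨z, x⟩; simp [G, Set.indicator]; rfl
      rw [this]
      exact (hg.min measurable_const).indicator (measurable_snd (hS j))
    have hGz : ∀ j z, Measurable (G j z) := fun j z => (hG j).comp measurable_prodMk_left
    have hGle : ∀ j z x, G j z x ≤ g z x := by
      intro j z x
      simp only [G, Set.indicator]
      split_ifs
      · exact min_le_left _ _
      · exact zero_le
    let A : ℕ → Z → ℝ≥0∞ := fun j z => ∫⁻ x, G j z x ^ Q ∂μ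
    have hA : ∀ j, Measurable (A j) := fun j =>
      Measurable.lintegral_prod_right' (f := fun q : Z × X => uncurry (G j) q ^ Q)
        ((hG j).pow_const _)
    have hAfin : ∀ j z, A j z ≠ ∞ := by
      intro j z
      have : A j z ≤ ∫⁻ x, (S j).indicator (fun _ => (j : ℝ≥0∞) ^ Q) x ∂μ := by
        apply lintegral_mono
        intro x
        simp only [G, Set.indicator]
        split_ifs
        · exact ENNReal.rpow_le_rpow (min_le_right _ _) hQ.le
        · simp [hQ]
      refine (this.trans_lt ?_).ne
      rw [lintegral_indicator_const (hS j)]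
      exact ENNReal.mul_lt_top (ENNReal.rpow_lt_top_of_nonneg hQ.le (by simp))
        (measure_spanningSets_lt_top μ j)
    refine ⟨fun j z x => G j z x ^ (Q - 1) * ((A j z) ^ (1 / P))⁻¹, ?_, ?_, ?_⟩
    · intro j
      exact ((hG j).pow_const _).mul (((hA j).comp measurable_fst).pow_const _).inv
    · intro j z
      have h1 : ∀ x, (G j z x ^ (Q - 1) * ((A j z) ^ (1 / P))⁻¹) ^ P
          = G j z x ^ Q * (A j z)⁻¹ := by
        intro x
        rw [ENNReal.mul_rpow_of_nonneg _ _ hP.le, ← ENNReal.rpow_mul, ENNReal.inv_rpow,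
          ← ENNReal.rpow_mul, one_div_mul_cancel hP.ne', ENNReal.rpow_one,
          hpq.symm.sub_one_mul_conj]
      simp only [h1]
      rw [lintegral_mul_const _ ((hGz j z).pow_const _)]
      calc (A j z * (A j z)⁻¹) ^ (1 / P) ≤ 1 ^ (1 / P) :=
            ENNReal.rpow_le_rpow (ENNReal.mul_inv_le_one _) (by positivity)
        _ = 1 := ENNReal.one_rpow _
    · intro z
      have hlow : ∀ j, (A j z) ^ (1 / Q) ≤
          ∫⁻ x, G j z x ^ (Q - 1) * ((A j z) ^ (1 / P))⁻¹ * g z x ∂μ := by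
        intro j
        by_cases h0 : A j z = 0
        · rw [h0, ENNReal.zero_rpow_of_pos (by positivity)]; exact zero_le
        calc (A j z) ^ (1 / Q) = A j z * ((A j z) ^ (1 / P))⁻¹ := by
              rw [← ENNReal.rpow_neg]
              nth_rw 2 [← ENNReal.rpow_one (A j z)]
              rw [← ENNReal.rpow_add _ _ h0 (hAfin j z)]
              congr 1
              have := hpq.inv_add_inv_eq_one
              simp only [one_div]; linarith
          _ = ∫⁻ x, G j z x ^ Q * ((A j z) ^ (1 / P))⁻¹ ∂μ := by
              rw [lintegral_mul_const _ ((hGz j z).pow_const _)]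
          _ ≤ _ := by
              apply lintegral_mono
              intro x
              have : G j z x ^ Q = G j z x ^ (Q - 1) * G j z x := by
                conv_rhs => rw [← ENNReal.rpow_one (G j z x), ← ENNReal.rpow_mul, one_mul]
                rw [← ENNReal.rpow_add_of_nonneg _ _ hQ1 zero_le_one]
                simp
              simp only [this]
              rw [mul_right_comm]
              gcongr
              exact hGle j z x
      have hGmono : ∀ x, Monotone fun j => G j z x := by
        intro x i j hij
        simp only [G, Set.indicator]
        by_cases hx : x ∈ S i
        · have hx' : x ∈ S j := monotone_spanningSets μ hij hx
          simp only [hx, hx', if_true]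
          exact min_le_min le_rfl (by exact_mod_cast hij)
        · simp [hx]
      have hGt : ∀ x, Tendsto (fun j => G j z x) atTop (𝓝 (g z x)) := by
        intro x
        have h1 : ∀ᶠ j in atTop, G j z x = min (g z x) (j : ℝ≥0∞) := by
          obtain ⟨i, hi⟩ : ∃ i, x ∈ S i := by
            have : x ∈ ⋃ i, S i := by
              rw [iUnion_spanningSets]; trivial
            simpa using this
          filter_upwards [eventually_ge_atTop i] with j hj
          have hx' : x ∈ S j := monotone_spanningSets μ hj hi
          simp [G, hx']
        rw [tendsto_congr' h1]
        have := (tendsto_const_nhds (x := g z x) (f := (atTop : Filter ℕ))).min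
          ENNReal.tendsto_nat_nhds_top
        simpa using this
      have hAt : Tendsto (fun j => A j z) atTop (𝓝 (∫⁻ x, g z x ^ Q ∂μ)) := by
        apply lintegral_tendsto_of_tendsto_of_monotone
        · intro j; exact ((hGz j z).pow_const _).aemeasurable
        · refine Eventually.of_forall fun x i j hij => ?_
          exact ENNReal.rpow_le_rpow (hGmono x hij) hQ.le
        · refine Eventually.of_forall fun x => ?_
          exact ((ENNReal.continuous_rpow_const (y := Q)).tendsto _).comp (hGt x)
      have hAt2 := ((ENNReal.continuous_rpow_const (y := 1 / Q)).tendsto _).comp hAt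
      refine le_of_tendsto' hAt2 fun j => ?_
      exact (hlow j).trans (le_iSup (fun j => ∫⁻ x, G j z x ^ (Q - 1) * ((A j z) ^ (1 / P))⁻¹ * g z x ∂μ) j)

theorem LN_du {X : Type} [MeasurableSpace X] (μ : Measure X) [SigmaFinite μ] (p q : ℝ≥0∞)
    (hp : 1 ≤ p) (hpt : p ≠ ∞) (h : 1 / p + 1 / q = 1) :
    Du μ (LN p μ) (LN q μ) := by
  rcases conj_cases p q hp hpt h with ⟨rfl, rfl⟩ | ⟨hq, hc⟩
  · exact LN_du_one μ
  · exact LN_du_gt μ p q hpt hq hc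


theorem Du.ext_mono {X : Type} [MeasurableSpace X] {μ : Measure X} [SFinite μ]
    {N N' : (X → ℝ≥0∞) → ℝ≥0∞}
    (h : Du μ N N') {Z : Type} [MeasurableSpace Z] (g : Z → X → ℝ≥0∞)
    (hg : Measurable (uncurry g)) :
    ∃ f : ℕ → Z → X → ℝ≥0∞, (∀ j, Measurable (uncurry (f j))) ∧
      (∀ j z, N (f j z) ≤ 1) ∧ (∀ z, Monotone fun j => ∫⁻ x, f j z x * g z x ∂μ) ∧
      ∀ z, N' (g z) ≤ ⨆ j, ∫⁻ x, f j z x * g z x ∂μ := by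
  classical
  obtain ⟨f, hf, hN, hs⟩ := h.ext g hg
  let I : (Z → X → ℝ≥0∞) → Z → ℝ≥0∞ := fun φ z => ∫⁻ x, φ z x * g z x ∂μ
  have hI : ∀ φ : Z → X → ℝ≥0∞, Measurable (uncurry φ) → Measurable (I φ) := fun φ hφ =>
    Measurable.lintegral_prod_right' (f := fun q : Z × X => uncurry φ q * uncurry g q)
      (hφ.mul hg)
  let F : ℕ → Z → X → ℝ≥0∞ := fun j => Nat.rec (f 0)
    (fun j φ => fun z => if I φ z ≤ I (f (j + 1)) z then f (j + 1) z else φ z) j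
  have hF1 : ∀ j z, F (j + 1) z =
    if I (F j) z ≤ I (f (j + 1)) z then f (j + 1) z else F j z := fun j z => rfl
  have hFm : ∀ j, Measurable (uncurry (F j)) := by
    intro j
    induction j with
    | zero => exact hf 0
    | succ j ih =>
      have : uncurry (F (j + 1)) = fun q : Z × X =>
          if I (F j) q.1 ≤ I (f (j + 1)) q.1 then uncurry (f (j + 1)) q else uncurry (F j) q := by
        ext ⟨z, x⟩
        simp only [uncurry, hF1]
        split_ifs <;> rfl
      rw [this]
      exact Measurable.ite (measurableSet_le ((hI _ ih).comp measurable_fst)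
        ((hI _ (hf _)).comp measurable_fst)) (hf _) ih
  have hFN : ∀ j z, N (F j z) ≤ 1 := by
    intro j z
    induction j with
    | zero => exact hN 0 z
    | succ j ih =>
      rw [hF1]
      split_ifs
      · exact hN _ _
      · exact ih
  have hle1 : ∀ j z, I (F j) z ≤ I (F (j + 1)) z := by
    intro j z
    show _ ≤ ∫⁻ x, F (j + 1) z x * g z x ∂μ
    rw [hF1]
    split_ifs with hc
    · exact hc
    · exact le_rfl
  have hle2 : ∀ j z, I (f j) z ≤ I (F j) z := by
    intro j z
    cases j with
    | zero => exact le_rfl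
    | succ j =>
      show _ ≤ ∫⁻ x, F (j + 1) z x * g z x ∂μ
      rw [hF1]
      split_ifs with hc
      · exact le_rfl
      · exact (not_le.1 hc).le
  refine ⟨F, hFm, hFN, fun z => monotone_nat_of_le_succ fun j => hle1 j z, fun z => ?_⟩
  exact (hs z).trans (iSup_mono fun j => hle2 j z)

/-- iterated norm -/
def cmp {X Y : Type} (NY : (Y → ℝ≥0∞) → ℝ≥0∞) (NX : (X → ℝ≥0∞) → ℝ≥0∞) :
    (Y × X → ℝ≥0∞) → ℝ≥0∞ := fun g => NY fun y => NX fun x => g (y, x)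

section cmp
set_option linter.unusedSectionVars false
variable {X Y : Type} [MeasurableSpace X] [MeasurableSpace Y] {μ : Measure X} {ν : Measure Y}
  [SFinite μ] [SFinite ν] {NX NX' : (X → ℝ≥0∞) → ℝ≥0∞} {NY NY' : (Y → ℝ≥0∞) → ℝ≥0∞}

theorem Nm.cmp (hY : Nm ν NY) (hX : Nm μ NX) : Nm (ν.prod μ) (cmp NY NX) := by
  refine ⟨?_, ?_, ?_⟩
  · intro Z _ g hg
    refine hY.meas (fun z y => NX fun x => g z (y, x)) ?_
    refine hX.meas (fun (q : Z × Y) x => g q.1 (q.2, x)) ?_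
    exact hg.comp (f := fun q : (Z × Y) × X => (q.1.1, (q.1.2, q.2))) (by fun_prop)
  · intro c g hg
    unfold MixedAmalgam.cmp
    have : ∀ y, NX (fun x => c * g (y, x)) = c * NX fun x => g (y, x) := fun y =>
      hX.smul c _ (hg.comp measurable_prodMk_left)
    simp only [this]
    exact hY.smul c _ (hX.meas (fun y x => g (y, x)) hg)
  · intro f g h
    refine hY.mono _ _ ?_
    filter_upwards [Measure.ae_ae_of_ae_prod h] with y hy
    exact hX.mono _ _ hy

theorem Fc.cmp (hY : Fc ν NY) (hX : Fc μ NX) (mY : Nm ν NY) (mX : Nm μ NX) :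
    Fc (ν.prod μ) (cmp NY NX) := by
  refine ⟨?_, ?_, ?_⟩
  · intro h hm hh
    rw [Measure.ae_prod_iff_ae_ae (measurableSet_lt hm measurable_const)]
    filter_upwards [hY.fin _ (mX.meas (fun y x => h (y, x)) hm) hh] with y hy
    exact hX.fin _ (hm.comp measurable_prodMk_left) hy
  · intro f F hf hF hN hle ht
    refine hY.oc (fun m y => NX fun x => f m (y, x)) (fun y => NX fun x => F (y, x))
      (fun m => mX.meas (fun y x => f m (y, x)) (hf m)) (mX.meas (fun y x => F (y, x)) hF) hN ?_ ?_
    · filter_upwards [Measure.ae_ae_of_ae_prod hle] with y hy m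
      refine mX.mono _ _ ?_
      filter_upwards [hy] with x hx using hx m
    · filter_upwards [Measure.ae_ae_of_ae_prod hle, Measure.ae_ae_of_ae_prod ht,
        hY.fin _ (mX.meas (fun y x => F (y, x)) hF) hN] with y h1 h2 h3
      exact hX.oc (fun m x => f m (y, x)) (fun x => F (y, x))
        (fun m => (hf m).comp measurable_prodMk_left) (hF.comp measurable_prodMk_left) h3 h1 h2
  · obtain ⟨w, wm, w0, w1, wN⟩ := hX.pos
    obtain ⟨v, vm, v0, v1, vN⟩ := hY.pos
    refine ⟨fun q => v q.1 * w q.2, by fun_prop, fun q => ENNReal.mul_pos (v0 _).ne' (w0 _).ne',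
      fun q => mul_le_one' (v1 _) (w1 _), ?_⟩
    unfold MixedAmalgam.cmp
    have : ∀ y, NX (fun x => v y * w x) = NX w * v y := fun y => by
      rw [mX.smul _ _ wm, mul_comm]
    simp only [this]
    rw [mY.smul _ _ vm]
    exact ENNReal.mul_lt_top wN vN

theorem Du.cmp (hY : Du ν NY NY') (hX : Du μ NX NX') (mY : Nm ν NY) (mX : Nm μ NX)
    (mX' : Nm μ NX') :
    Du (ν.prod μ) (cmp NY NX) (cmp NY' NX') := by
  refine ⟨?_, ?_⟩
  · intro f g hf hg
    rw [lintegral_prod _ (by fun_prop)]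
    refine le_trans (lintegral_mono fun y => hX.holder (fun x => f (y, x)) (fun x => g (y, x))
      (hf.comp measurable_prodMk_left) (hg.comp measurable_prodMk_left)) ?_
    exact hY.holder _ _ (mX.meas (fun y x => f (y, x)) hf) (mX'.meas (fun y x => g (y, x)) hg)
  · intro Z _ g hg
    have hg1 : Measurable (uncurry fun (q : Z × Y) (x : X) => g q.1 (q.2, x)) :=
      hg.comp (f := fun q : (Z × Y) × X => (q.1.1, (q.1.2, q.2))) (by fun_prop)
    obtain ⟨f, hf, hfN, hfm, hfs⟩ := hX.ext_mono _ hg1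
    obtain ⟨φ, hφ, hφN, hφs⟩ := hY.ext (fun z y => NX' fun x => g z (y, x)) (mX'.meas _ hg1)
    have hF : ∀ i j, Measurable (uncurry fun (z : Z) (q : Y × X) => φ i z q.1 * f j (z, q.1) q.2) := by
      intro i j
      exact ((hφ i).comp (f := fun q : Z × (Y × X) => (q.1, q.2.1)) (by fun_prop)).mul
        ((hf j).comp (f := fun q : Z × (Y × X) => ((q.1, q.2.1), q.2.2)) (by fun_prop))
    refine ⟨fun m z q => φ m.unpair.1 z q.1 * f m.unpair.2 (z, q.1) q.2, fun m => hF _ _, ?_, ?_⟩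
    · intro m z
      refine le_trans (mY.mono _ _ (Eventually.of_forall fun y => ?_)) (hφN m.unpair.1 z)
      show NX (fun x => φ m.unpair.1 z y * f m.unpair.2 (z, y) x) ≤ φ m.unpair.1 z y
      rw [mX.smul _ (f m.unpair.2 (z, y)) ((hf _).comp measurable_prodMk_left)]
      exact mul_le_of_le_one_right' (hfN _ _)
    · intro z
      refine (hφs z).trans (iSup_le fun i => ?_)
      have hH : ∀ j, Measurable fun y => ∫⁻ x, f j (z, y) x * g z (y, x) ∂μ := fun j =>
        Measurable.lintegral_prod_right'
          (f := fun q : Y × X => f j (z, q.1) q.2 * g z q)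
          (((hf j).comp (f := fun q : Y × X => ((z, q.1), q.2)) (by fun_prop)).mul
            (hg.comp measurable_prodMk_left))
      have hφz : Measurable (φ i z) := (hφ i).comp measurable_prodMk_left
      calc ∫⁻ y, φ i z y * NX' (fun x => g z (y, x)) ∂ν
          ≤ ∫⁻ y, ⨆ j, φ i z y * ∫⁻ x, f j (z, y) x * g z (y, x) ∂μ ∂ν := by
            apply lintegral_mono
            intro y
            simp only
            rw [← ENNReal.mul_iSup]
            gcongr
            exact hfs (z, y)
        _ = ⨆ j, ∫⁻ y, φ i z y * ∫⁻ x, f j (z, y) x * g z (y, x) ∂μ ∂ν := by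
            refine lintegral_iSup (fun j => hφz.mul (hH j)) ?_
            intro j k hjk y
            simp only
            exact mul_le_mul_right (hfm (z, y) hjk) _
        _ ≤ _ := by
            refine iSup_le fun j => le_trans (le_of_eq ?_) (le_iSup _ (Nat.pair i j))
            simp only [Nat.unpair_pair]
            rw [lintegral_prod]
            · refine lintegral_congr fun y => ?_
              rw [← lintegral_const_mul]
              · simp only [mul_assoc]
              · exact ((hf j).comp measurable_prodMk_left).mul
                  (hg.comp (f := fun x => (z, (y, x))) (by fun_prop))
            · exact (((hF i j).comp measurable_prodMk_left).mul
                (hg.comp measurable_prodMk_left)).aemeasurable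

end cmp

section transfer
variable {X Y : Type} [MeasurableSpace X] [MeasurableSpace Y] {μ : Measure X} {ν : Measure Y}
  {N N' : (Y → ℝ≥0∞) → ℝ≥0∞} (e : X ≃ᵐ Y)

theorem Nm.tr (he : MeasurePreserving e μ ν) (h : Nm ν N) : Nm μ (fun g => N (g ∘ e.symm)) := by
  refine ⟨?_, ?_, ?_⟩
  · intro Z _ g hg
    exact h.meas (fun z y => g z (e.symm y)) (hg.comp (f := fun q : Z × Y => (q.1, e.symm q.2))
      (by fun_prop))
  · intro c g hg
    exact h.smul c (g ∘ e.symm) (hg.comp e.symm.measurable)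
  · intro f g hfg
    exact h.mono _ _ (he.symm e |>.quasiMeasurePreserving.ae hfg)

theorem Fc.tr (he : MeasurePreserving e μ ν) (h : Fc ν N) : Fc μ (fun g => N (g ∘ e.symm)) := by
  refine ⟨?_, ?_, ?_⟩
  · intro g hg hN
    have := he.quasiMeasurePreserving.ae (h.fin _ (hg.comp e.symm.measurable) hN)
    simpa using this
  · intro f F hf hF hN h1 h2
    exact h.oc (fun m => f m ∘ e.symm) (F ∘ e.symm) (fun m => (hf m).comp e.symm.measurable)
      (hF.comp e.symm.measurable) hN (he.symm e |>.quasiMeasurePreserving.ae h1)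
      (he.symm e |>.quasiMeasurePreserving.ae h2)
  · obtain ⟨w, wm, w0, w1, wN⟩ := h.pos
    refine ⟨w ∘ e, wm.comp e.measurable, fun x => w0 _, fun x => w1 _, ?_⟩
    simpa [Function.comp_assoc] using wN

theorem Du.tr (he : MeasurePreserving e μ ν) (h : Du ν N N') : Du μ (fun g => N (g ∘ e.symm)) (fun g => N' (g ∘ e.symm)) := by
  have hI : ∀ φ : X → ℝ≥0∞, ∫⁻ x, φ x ∂μ = ∫⁻ y, φ (e.symm y) ∂ν := by
    intro φ
    rw [← he.lintegral_comp_emb e.measurableEmbedding]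
    simp
  refine ⟨?_, ?_⟩
  · intro f g hf hg
    rw [hI]
    exact h.holder (f ∘ e.symm) (g ∘ e.symm) (hf.comp e.symm.measurable)
      (hg.comp e.symm.measurable)
  · intro Z _ g hg
    obtain ⟨f, hf, hN, hs⟩ := h.ext (fun z y => g z (e.symm y))
      (hg.comp (f := fun q : Z × Y => (q.1, e.symm q.2)) (by fun_prop))
    refine ⟨fun j z x => f j z (e x),
      fun j => (hf j).comp (f := fun q : Z × X => (q.1, e q.2)) (by fun_prop), ?_, ?_⟩
    · intro j z
      simpa [Function.comp_def] using hN j z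
    · intro z
      refine (hs z).trans (le_of_eq ?_)
      congr 1; funext j
      rw [hI]
      simp

end transfer


set_option linter.unusedSectionVars false

/-- generic mixed norm -/
def mixG {α : Type} [MeasurableSpace α] (μ : Measure α) :
    (n : ℕ) → (Fin n → ℝ≥0∞) → ((Fin n → α) → ℝ≥0∞) → ℝ≥0∞
  | 0, _, g => g Fin.elim0
  | n + 1, p, g =>
    LN (p (Fin.last n)) μ fun t =>
      mixG μ n (fun i => p i.castSucc) fun x => g (Fin.snoc x t)

theorem mixedE_eq (n : ℕ) (p : Fin n → ℝ≥0∞) : mixedE n p = mixG volume n p := by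
  induction n with
  | zero => rfl
  | succ n ih =>
    funext g
    simp only [mixedE, mixG, ih]
    rfl

theorem lpSum_eq (p : ℝ≥0∞) (g : ℤ → ℝ≥0∞) : lpSum p g = LN p Measure.count g := by
  simp [lpSum, LN, lintegral_count]

theorem mixedSeq_eq (n : ℕ) (p : Fin n → ℝ≥0∞) : mixedSeq n p = mixG Measure.count n p := by
  induction n with
  | zero => rfl
  | succ n ih =>
    funext g
    simp only [mixedSeq, mixG, ih, lpSum_eq]

section mix
variable {α : Type} [MeasurableSpace α] (μ : Measure α) [SigmaFinite μ]

theorem mixG_succ (n : ℕ) (p : Fin (n + 1) → ℝ≥0∞) :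
    mixG μ (n + 1) p = fun g => cmp (LN (p (Fin.last n)) μ) (mixG μ n (fun i => p i.castSucc))
      (g ∘ (MeasurableEquiv.piFinSuccAbove (fun _ => α) (Fin.last n)).symm) := by
  funext g
  simp only [mixG, cmp, Function.comp_apply, MeasurableEquiv.piFinSuccAbove_symm_apply]
  congr 1; funext t; congr 1; funext x; congr 1
  exact (Fin.insertNth_last' t x).symm

theorem mp_last (n : ℕ) : MeasurePreserving (MeasurableEquiv.piFinSuccAbove (fun _ => α) (Fin.last n))
    (Measure.pi fun _ : Fin (n + 1) => μ) (μ.prod (Measure.pi fun _ : Fin n => μ)) :=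
  measurePreserving_piFinSuccAbove (fun _ => μ) (Fin.last n)

theorem ae_zero (P : (Fin 0 → α) → Prop) :
    (∀ᵐ x ∂(Measure.pi fun _ : Fin 0 => μ), P x) ↔ P Fin.elim0 := by
  constructor
  · intro h
    have : (Measure.pi fun _ : Fin 0 => μ) ≠ 0 := by
      intro h0
      have := Measure.pi_empty_univ (fun _ : Fin 0 => μ)
      simp [h0] at this
    have : (ae (Measure.pi fun _ : Fin 0 => μ)).NeBot := ae_neBot.2 this
    obtain ⟨x, hx⟩ := h.exists
    rwa [Subsingleton.elim Fin.elim0 x]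
  · intro h
    refine Eventually.of_forall fun x => ?_
    rwa [Subsingleton.elim x Fin.elim0]

theorem lintegral_zero' (f : (Fin 0 → α) → ℝ≥0∞) :
    ∫⁻ x, f x ∂(Measure.pi fun _ : Fin 0 => μ) = f Fin.elim0 := by
  have : f = fun _ => f Fin.elim0 := by
    funext x; rw [Subsingleton.elim x Fin.elim0]
  rw [this, lintegral_const, Measure.pi_empty_univ, mul_one]

theorem mixG_nm (n : ℕ) (p : Fin n → ℝ≥0∞) (hp : ∀ i, 1 ≤ p i) :
    Nm (Measure.pi fun _ : Fin n => μ) (mixG μ n p) := by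
  induction n with
  | zero =>
    refine ⟨?_, ?_, ?_⟩
    · intro Z _ g hg
      exact hg.comp (measurable_prodMk_right (y := Fin.elim0))
    · intro c g hg; rfl
    · intro f g h
      exact (ae_zero μ _).1 h
  | succ n ih =>
    rw [mixG_succ]
    exact Nm.tr _ (mp_last μ n) (Nm.cmp (LN_nm μ _ (hp _)) (ih _ fun i => hp _))

theorem mixG_fc (n : ℕ) (p : Fin n → ℝ≥0∞) (hp : ∀ i, 1 ≤ p i ∧ p i ≠ ∞) :
    Fc (Measure.pi fun _ : Fin n => μ) (mixG μ n p) := by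
  induction n with
  | zero =>
    refine ⟨?_, ?_, ?_⟩
    · intro h _ hh
      exact (ae_zero μ _).2 hh
    · intro f F _ _ _ _ h
      exact (ae_zero μ _).1 h
    · exact ⟨fun _ => 1, measurable_const, by simp, by simp, by simp [mixG]⟩
  | succ n ih =>
    rw [mixG_succ]
    exact Fc.tr _ (mp_last μ n) (Fc.cmp (LN_fc μ _ (hp _).1 (hp _).2) (ih _ fun i => hp _)
      (LN_nm μ _ (hp _).1) (mixG_nm μ n _ fun i => (hp _).1))

theorem mixG_du (n : ℕ) (p q : Fin n → ℝ≥0∞) (hp : ∀ i, 1 ≤ p i ∧ p i ≠ ∞)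
    (hq : ∀ i, 1 / p i + 1 / q i = 1) :
    Du (Measure.pi fun _ : Fin n => μ) (mixG μ n p) (mixG μ n q) := by
  induction n with
  | zero =>
    refine ⟨?_, ?_⟩
    · intro f g _ _
      rw [lintegral_zero']
      rfl
    · intro Z _ g hg
      refine ⟨fun _ _ _ => 1, fun _ => measurable_const, by simp [mixG], ?_⟩
      intro z
      simp [lintegral_zero', mixG]
  | succ n ih =>
    rw [mixG_succ, mixG_succ]
    exact Du.tr _ (mp_last μ n) (Du.cmp (LN_du μ _ _ (hp _).1 (hp _).2 (hq _))
      (ih _ _ (fun i => hp _) (fun i => hq _))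
      (LN_nm μ _ (hp _).1) (mixG_nm μ n _ fun i => (hp _).1)
      (mixG_nm μ n _ fun i => one_le_conj _ _ (hq _)))

theorem LN_ind (p : ℝ≥0∞) (S : Set α) (hS : MeasurableSet S) (hm : μ S ≠ ∞) (hp : 1 ≤ p) :
    LN p μ (S.indicator 1) < ∞ := by
  unfold LN
  split_ifs with h
  · refine lt_of_le_of_lt (b := 1) ?_ (by simp)
    refine essSup_le_of_ae_le _ (Eventually.of_forall fun x => ?_)
    exact Set.indicator_le_self' (by simp) x
  · have hp0 : 0 < p.toReal := ENNReal.toReal_pos (by rintro rfl; simp at hp) h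
    apply ENNReal.rpow_lt_top_of_nonneg (by positivity)
    have : ∀ t, S.indicator (1 : α → ℝ≥0∞) t ^ p.toReal = S.indicator 1 t := by
      intro t
      by_cases ht : t ∈ S <;> simp [ht, hp0]
    simp only [this]
    rwa [lintegral_indicator_one hS]

theorem mixG_box (n : ℕ) (p : Fin n → ℝ≥0∞) (S : Set α) (hS : MeasurableSet S) (hm : μ S ≠ ∞)
    (hp : ∀ i, 1 ≤ p i) :
    mixG μ n p ((Set.univ.pi fun _ => S).indicator 1) < ∞ := by
  induction n with
  | zero => simp [mixG, Set.indicator]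
  | succ n ih =>
    simp only [mixG]
    have h1 : ∀ t, (fun x : Fin n → α => (Set.univ.pi fun _ : Fin (n + 1) => S).indicator
        (1 : (Fin (n + 1) → α) → ℝ≥0∞) (Fin.snoc x t)) =
        fun x => S.indicator 1 t * (Set.univ.pi fun _ : Fin n => S).indicator 1 x := by
      intro t
      funext x
      have : (Fin.snoc x t : Fin (n + 1) → α) ∈ (Set.univ.pi fun _ : Fin (n + 1) => S) ↔
          t ∈ S ∧ x ∈ (Set.univ.pi fun _ : Fin n => S) := by
        simp [Set.mem_pi, Fin.forall_fin_succ', and_comm]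
      by_cases ht : t ∈ S <;> by_cases hx : x ∈ (Set.univ.pi fun _ : Fin n => S) <;>
        simp only [Set.indicator, this, ht, hx] <;> simp
    simp only [h1]
    have hb : MeasurableSet (Set.univ.pi fun _ : Fin n => S) :=
      MeasurableSet.univ_pi fun _ => hS
    simp only [fun t => (mixG_nm μ n (fun i => p i.castSucc) fun i => hp _).smul
      (S.indicator 1 t) _ (measurable_one.indicator hb)]
    have h2 := (LN_nm μ (p (Fin.last n)) (hp _)).smul
      (mixG μ n (fun i => p i.castSucc) ((Set.univ.pi fun _ => S).indicator 1))
      (S.indicator 1) (measurable_one.indicator hS)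
    simp only [mul_comm] at h2 ⊢
    rw [h2]
    exact ENNReal.mul_lt_top (LN_ind μ _ S hS hm (hp _)) (ih _ fun i => hp _)

end mix

section sect
variable {X Y : Type} [MeasurableSpace X] [MeasurableSpace Y] {μ : Measure X} {ν : Measure Y}
  [SFinite μ] [SFinite ν] {N N' : (Y × X → ℝ≥0∞) → ℝ≥0∞}

/-- lift along a section -/
def lft {X Y : Type} (κ : X → Y) (f : X → ℝ≥0∞) : Y × X → ℝ≥0∞ :=
  {q : Y × X | κ q.2 = q.1}.indicator fun q => f q.2

theorem lft_le {κ : X → Y} {f : Y × X → ℝ≥0∞} (q : Y × X) :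
    lft κ (fun x => f (κ x, x)) q ≤ f q := by
  obtain ⟨y, x⟩ := q
  unfold lft
  by_cases h : κ x = y
  · simp [Set.indicator, h]
  · simp [Set.indicator, h]

theorem lft_meas [Countable Y] [MeasurableSingletonClass Y] {κ : X → Y} (hκ : Measurable κ) :
    MeasurableSet {q : Y × X | κ q.2 = q.1} :=
  measurableSet_eq_fun (hκ.comp measurable_snd) measurable_fst

theorem Nm.lft [Countable Y] [MeasurableSingletonClass Y] {κ : X → Y} (hκ : Measurable κ)
    (h : Nm (ν.prod μ) N) : Nm μ (fun f => N (lft κ f)) := by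
  refine ⟨?_, ?_, ?_⟩
  · intro Z _ g hg
    refine h.meas (fun z => MixedAmalgam.lft κ (g z)) ?_
    have : (uncurry fun z => MixedAmalgam.lft κ (g z)) =
        ((Prod.snd : Z × (Y × X) → Y × X) ⁻¹' {q : Y × X | κ q.2 = q.1}).indicator
          fun r => g r.1 r.2.2 := by
      ext ⟨z, q⟩; simp [MixedAmalgam.lft, Set.indicator]
    rw [this]
    exact (hg.comp (f := fun r : Z × (Y × X) => (r.1, r.2.2)) (by fun_prop)).indicator
      (measurable_snd (lft_meas hκ))
  · intro c g hg
    have : MixedAmalgam.lft κ (fun x => c * g x) = fun q => c * MixedAmalgam.lft κ g q := by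
      ext q; simp [MixedAmalgam.lft, Set.indicator]
    rw [this]
    exact h.smul c _ ((hg.comp measurable_snd).indicator (lft_meas hκ))
  · intro f g hfg
    refine h.mono _ _ ?_
    filter_upwards [Measure.quasiMeasurePreserving_snd.ae hfg] with q hq
    exact Set.indicator_le_indicator hq

theorem Fc.lft [Countable Y] [MeasurableSingletonClass Y] {κ : X → Y} (hκ : Measurable κ)
    (hν : ∀ y, ν {y} = 1)
    (h : Fc (ν.prod μ) N) (m : Nm (ν.prod μ) N) : Fc μ (fun f => N (lft κ f)) := by
  have hm : ∀ f : X → ℝ≥0∞, Measurable f → Measurable (MixedAmalgam.lft κ f) := fun f hf =>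
    (hf.comp measurable_snd).indicator (lft_meas hκ)
  refine ⟨?_, ?_, ?_⟩
  · intro g hg hN
    have h1 := h.fin _ (hm g hg) hN
    have h2 := Measure.ae_ae_of_ae_prod h1
    have h3 : ∀ y, ∀ᵐ x ∂μ, MixedAmalgam.lft κ g (y, x) < ∞ := by
      intro y
      by_contra hc
      have : ν {y} = 0 := measure_mono_null (by
        intro y' hy'
        simp only [Set.mem_singleton_iff] at hy'
        subst hy'; exact hc) (ae_iff.1 h2)
      simp [hν] at this
    filter_upwards [ae_all_iff.2 h3] with x hx
    simpa [MixedAmalgam.lft] using hx (κ x)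
  · intro f F hf hF hN h1 h2
    refine h.oc (fun m => MixedAmalgam.lft κ (f m)) (MixedAmalgam.lft κ F) (fun m => hm _ (hf m))
      (hm _ hF) hN ?_ ?_
    · filter_upwards [Measure.quasiMeasurePreserving_snd.ae h1] with q hq m
      exact Set.indicator_le_indicator (hq m)
    · filter_upwards [Measure.quasiMeasurePreserving_snd.ae h2] with q hq
      by_cases hc : κ q.2 = q.1
      · simpa [MixedAmalgam.lft, Set.indicator, hc] using hq
      · simp [MixedAmalgam.lft, Set.indicator, hc]
  · obtain ⟨w, wm, w0, w1, wN⟩ := h.pos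
    refine ⟨fun x => w (κ x, x), wm.comp (hκ.prodMk measurable_id), fun x => w0 _, fun x => w1 _, ?_⟩
    exact (m.mono _ _ (Eventually.of_forall fun q => lft_le q)).trans_lt wN

theorem Du.lft [Countable Y] [MeasurableSingletonClass Y] {κ : X → Y} (hκ : Measurable κ)
    (hν : ∀ y, ν {y} = 1)
    (h : Du (ν.prod μ) N N') (m : Nm (ν.prod μ) N) :
    Du μ (fun f => N (lft κ f)) (fun f => N' (lft κ f)) := by
  have hm : ∀ f : X → ℝ≥0∞, Measurable f → Measurable (MixedAmalgam.lft κ f) := fun f hf =>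
    (hf.comp measurable_snd).indicator (lft_meas hκ)
  have hI : ∀ (f : Y × X → ℝ≥0∞) (g : X → ℝ≥0∞), Measurable f → Measurable g →
      ∫⁻ q, f q * MixedAmalgam.lft κ g q ∂(ν.prod μ) = ∫⁻ x, f (κ x, x) * g x ∂μ := by
    intro f g hf hg
    refine (lintegral_prod_symm _ (hf.mul (hm g hg)).aemeasurable).trans ?_
    refine lintegral_congr fun x => ?_
    have : ∀ y, f (y, x) * MixedAmalgam.lft κ g (y, x) =
        ({κ x} : Set Y).indicator (fun _ => f (κ x, x) * g x) y := by
      intro y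
      by_cases hc : κ x = y
      · subst hc; simp [MixedAmalgam.lft]
      · have hc' : ¬ y = κ x := fun h => hc h.symm
        simp [MixedAmalgam.lft, Set.indicator, hc, hc']
    refine (lintegral_congr this).trans ?_
    rw [lintegral_indicator_const (MeasurableSet.singleton _), hν, mul_one]
  refine ⟨?_, ?_⟩
  · intro f g hf hg
    have := h.holder _ _ (hm f hf) (hm g hg)
    rw [hI _ _ (hm f hf) hg] at this
    simpa [MixedAmalgam.lft] using this
  · intro Z _ g hg
    obtain ⟨f, hf, hN, hs⟩ := h.ext (fun z => MixedAmalgam.lft κ (g z)) (by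
      have : (uncurry fun z => MixedAmalgam.lft κ (g z)) =
        ((Prod.snd : Z × (Y × X) → Y × X) ⁻¹' {q : Y × X | κ q.2 = q.1}).indicator
          fun r => g r.1 r.2.2 := by
        ext ⟨z, q⟩; simp [MixedAmalgam.lft, Set.indicator]
      rw [this]
      exact (hg.comp (f := fun r : Z × (Y × X) => (r.1, r.2.2)) (by fun_prop)).indicator
        (measurable_snd (lft_meas hκ)))
    refine ⟨fun j z x => f j z (κ x, x), fun j => (hf j).comp
      (f := fun r : Z × X => (r.1, (κ r.2, r.2))) (by fun_prop), ?_, ?_⟩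
    · intro j z
      exact (m.mono _ _ (Eventually.of_forall fun q => lft_le q)).trans (hN j z)
    · intro z
      refine (hs z).trans (le_of_eq ?_)
      congr 1; funext j
      exact hI _ _ ((hf j).comp measurable_prodMk_left) (hg.comp measurable_prodMk_left)

end sect


structure Good (n : ℕ) (N N' : ((Fin n → ℝ) → ℝ≥0∞) → ℝ≥0∞) : Prop where
  nm : Nm volume N
  nm' : Nm volume N'
  fc : Fc volume N
  du : Du volume N N'
  cpt : ∀ K : Set (Fin n → ℝ), IsCompact K → N (K.indicator 1) < ∞
  cpt' : ∀ K : Set (Fin n → ℝ), IsCompact K → N' (K.indicator 1) < ∞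

/-- `ℝ≥0∞`-valued version of the amalgam norm. -/
def DN (n : ℕ) (p s : Fin n → ℝ≥0∞) (f : (Fin n → ℝ) → ℝ≥0∞) : ℝ≥0∞ :=
  cmp (mixG (Measure.count : Measure ℤ) n s) (mixG (volume : Measure ℝ) n p)
    (lft (fun x i => ⌊x i⌋) f)

theorem discNorm_eq (n : ℕ) (p s : Fin n → ℝ≥0∞) (f : (Fin n → ℝ) → ℝ) :
    discNorm n p s f = DN n p s (fun x => ‖f x‖ₑ) := by
  unfold discNorm discNormR mixedLp DN cmp
  rw [mixedSeq_eq, mixedE_eq]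
  congr 1; funext k; congr 1; funext x
  have : x ∈ qcube n 1 k ↔ (fun i => ⌊x i⌋) = k := by
    simp only [qcube, Set.mem_ofPred_eq, one_mul, funext_iff, Int.floor_eq_iff]
  by_cases h : x ∈ qcube n 1 k
  · simp only [Set.indicator, h, if_true, lft, Set.mem_ofPred_eq, this.1 h]
    rfl
  · have h2 := fun hh => h (this.2 hh)
    simp only [Set.indicator, h, lft, Set.mem_ofPred_eq]
    simp
    exact fun hh => (h2 hh).elim

theorem DN_cpt (n : ℕ) (p s : Fin n → ℝ≥0∞) (hp : ∀ i, 1 ≤ p i) (hs : ∀ i, 1 ≤ s i)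
    (K : Set (Fin n → ℝ)) (hK : IsCompact K) : DN n p s (K.indicator 1) < ∞ := by
  obtain ⟨R, hR⟩ := hK.isBounded.subset_closedBall 0
  have hKR : ∀ x ∈ K, ∀ i, x i ∈ Set.Icc (-R) R := by
    intro x hx i
    have h1 := hR hx
    rw [mem_closedBall_zero_iff] at h1
    have h2 := (norm_le_pi_norm x i).trans h1
    rw [Real.norm_eq_abs, abs_le] at h2
    exact h2
  let S : Set ℝ := Set.Icc (-R) R
  let B : Set ℤ := Set.Icc ⌊-R⌋ ⌊R⌋
  have hA := mixG_box (volume : Measure ℝ) n p S measurableSet_Icc (by simp [S]) hp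
  have hB := mixG_box (Measure.count : Measure ℤ) n s B (MeasurableSet.of_discrete)
    (by rw [Measure.count_apply_finite _ (Set.finite_Icc _ _)]; simp) hs
  have mA := mixG_nm (volume : Measure ℝ) n p hp
  have mB := mixG_nm (Measure.count : Measure ℤ) n s hs
  have hle : DN n p s (K.indicator 1) ≤ cmp (mixG (Measure.count : Measure ℤ) n s)
      (mixG (volume : Measure ℝ) n p) (fun q => (Set.univ.pi fun _ => B).indicator 1 q.1 *
        (Set.univ.pi fun _ => S).indicator 1 q.2) := by
    refine (mB.cmp mA).mono _ _ (Eventually.of_forall fun q => ?_)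
    obtain ⟨k, x⟩ := q
    by_cases h : (fun i => ⌊x i⌋) = k
    · by_cases hx : x ∈ K
      · have h1 : x ∈ (Set.univ.pi fun _ : Fin n => S) := fun i _ => hKR x hx i
        have h2 : k ∈ (Set.univ.pi fun _ : Fin n => B) := by
          intro i _
          rw [← h]
          exact ⟨Int.floor_mono (hKR x hx i).1, Int.floor_mono (hKR x hx i).2⟩
        simp [lft, Set.indicator_of_mem h1, Set.indicator_of_mem h2, h, hx]
      · simp [lft, Set.indicator, hx]
    · simp [lft, Set.indicator, h]
  refine hle.trans_lt ?_
  unfold cmp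
  simp only
  have h1 : ∀ k : Fin n → ℤ, mixG (volume : Measure ℝ) n p (fun x =>
      (Set.univ.pi fun _ : Fin n => B).indicator 1 k * (Set.univ.pi fun _ : Fin n => S).indicator 1 x) =
      mixG (volume : Measure ℝ) n p ((Set.univ.pi fun _ : Fin n => S).indicator 1) *
        (Set.univ.pi fun _ : Fin n => B).indicator 1 k := by
    intro k
    rw [mA.smul _ _ (measurable_one.indicator (MeasurableSet.univ_pi fun _ => measurableSet_Icc)),
      mul_comm]
  simp only [h1]
  rw [mB.smul _ _ (measurable_one.indicator (MeasurableSet.of_discrete))]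
  exact ENNReal.mul_lt_top hA hB

theorem DN_good (n : ℕ) (p s p' s' : Fin n → ℝ≥0∞)
    (hp : ∀ i, 1 ≤ p i ∧ p i ≠ ∞) (hs : ∀ i, 1 ≤ s i ∧ s i ≠ ∞)
    (hp' : ∀ i, 1 / p i + 1 / p' i = 1) (hs' : ∀ i, 1 / s i + 1 / s' i = 1) :
    Good n (DN n p s) (DN n p' s') := by
  have q1 : ∀ i, 1 ≤ p' i := fun i => one_le_conj _ _ (hp' i)
  have r1 : ∀ i, 1 ≤ s' i := fun i => one_le_conj _ _ (hs' i)
  have mA := mixG_nm (volume : Measure ℝ) n p fun i => (hp i).1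
  have mB := mixG_nm (Measure.count : Measure ℤ) n s fun i => (hs i).1
  have mA' := mixG_nm (volume : Measure ℝ) n p' q1
  have mB' := mixG_nm (Measure.count : Measure ℤ) n s' r1
  have fA := mixG_fc (volume : Measure ℝ) n p hp
  have fB := mixG_fc (Measure.count : Measure ℤ) n s hs
  have dA := mixG_du (volume : Measure ℝ) n p p' hp hp'
  have dB := mixG_du (Measure.count : Measure ℤ) n s s' hs hs'
  have hκ : Measurable (fun (x : Fin n → ℝ) (i : Fin n) => ⌊x i⌋) := by
    refine measurable_pi_lambda _ fun i => ?_
    exact Int.measurable_floor.comp (measurable_pi_apply i)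
  have hν : ∀ y : Fin n → ℤ, (Measure.pi fun _ : Fin n => (Measure.count : Measure ℤ)) {y} = 1 := by
    intro y
    rw [Measure.pi_singleton]
    simp
  exact ⟨Nm.lft hκ (mB.cmp mA), Nm.lft hκ (mB'.cmp mA'), Fc.lft hκ hν (fB.cmp fA mB mA) (mB.cmp mA),
    Du.lft hκ hν (dB.cmp dA mB mA mA') (mB.cmp mA),
    DN_cpt n p s (fun i => (hp i).1) (fun i => (hs i).1), DN_cpt n p' s' q1 r1⟩


/-- membership in the abstract space. -/
def MD {n : ℕ} (N : ((Fin n → ℝ) → ℝ≥0∞) → ℝ≥0∞) (f : (Fin n → ℝ) → ℝ) : Prop :=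
  LocallyIntegrable f volume ∧ N (fun x => ‖f x‖ₑ) < ∞

section abs
variable {n : ℕ} {N N' : ((Fin n → ℝ) → ℝ≥0∞) → ℝ≥0∞}

theorem Nm.congr {N : ((Fin n → ℝ) → ℝ≥0∞) → ℝ≥0∞} (h : Nm volume N)
    {f g : (Fin n → ℝ) → ℝ≥0∞} (e : f =ᵐ[volume] g) : N f = N g :=
  le_antisymm (h.mono _ _ e.le) (h.mono _ _ e.symm.le)

theorem Good.holder (G : Good n N N') {f g : (Fin n → ℝ) → ℝ}
    (hf : AEStronglyMeasurable f volume) (hg : AEStronglyMeasurable g volume) :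
    ∫⁻ x, ‖f x * g x‖ₑ ≤ N (fun x => ‖f x‖ₑ) * N' (fun x => ‖g x‖ₑ) := by
  have e1 := hf.ae_eq_mk
  have e2 := hg.ae_eq_mk
  rw [G.nm.congr (g := fun x => ‖hf.mk f x‖ₑ) (by filter_upwards [e1] with x hx; rw [hx]),
    G.nm'.congr (g := fun x => ‖hg.mk g x‖ₑ) (by filter_upwards [e2] with x hx; rw [hx])]
  refine le_trans (le_of_eq ?_) (G.du.holder _ _ hf.stronglyMeasurable_mk.measurable.enorm
    hg.stronglyMeasurable_mk.measurable.enorm)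
  refine lintegral_congr_ae ?_
  filter_upwards [e1, e2] with x h1 h2
  rw [enorm_mul, ← h1, ← h2]

theorem Good.loc (G : Good n N N') {f : (Fin n → ℝ) → ℝ}
    (hf : AEStronglyMeasurable f volume) (h : N (fun x => ‖f x‖ₑ) < ∞) : MD N f := by
  refine ⟨?_, h⟩
  rw [locallyIntegrable_iff]
  intro K hK
  refine ⟨hf.restrict, ?_⟩
  have := G.holder (g := K.indicator 1) hf
    ((measurable_one.indicator hK.measurableSet).aestronglyMeasurable)
  have e : (fun x => ‖K.indicator (1 : (Fin n → ℝ) → ℝ) x‖ₑ) = K.indicator 1 := by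
    funext x; by_cases hx : x ∈ K <;> simp [hx]
  rw [e] at this
  unfold HasFiniteIntegral
  rw [← lintegral_indicator hK.measurableSet]
  refine lt_of_le_of_lt (le_trans (le_of_eq ?_) this) (ENNReal.mul_lt_top h (G.cpt' K hK))
  refine lintegral_congr fun x => ?_
  by_cases hx : x ∈ K <;> simp [hx]

theorem Good.loc' (G : Good n N N') {f : (Fin n → ℝ) → ℝ}
    (hf : AEStronglyMeasurable f volume) (h : N' (fun x => ‖f x‖ₑ) < ∞) : MD N' f := by
  refine ⟨?_, h⟩
  rw [locallyIntegrable_iff]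
  intro K hK
  refine ⟨hf.restrict, ?_⟩
  have := G.holder (f := K.indicator 1) (g := f)
    ((measurable_one.indicator hK.measurableSet).aestronglyMeasurable) hf
  have e : (fun x => ‖K.indicator (1 : (Fin n → ℝ) → ℝ) x‖ₑ) = K.indicator 1 := by
    funext x; by_cases hx : x ∈ K <;> simp [hx]
  rw [e] at this
  unfold HasFiniteIntegral
  rw [← lintegral_indicator hK.measurableSet]
  refine lt_of_le_of_lt (le_trans (le_of_eq ?_) this) (ENNReal.mul_lt_top (G.cpt K hK) h)
  refine lintegral_congr fun x => ?_
  by_cases hx : x ∈ K <;> simp [hx]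

theorem Good.conv (G : Good n N N') {f g : (Fin n → ℝ) → ℝ} (hf : MD N f) (hg : MD N' g) :
    Integrable (fun x => f x * g x) volume ∧
      ENNReal.ofReal |∫ x, f x * g x| ≤ N (fun x => ‖f x‖ₑ) * N' (fun x => ‖g x‖ₑ) := by
  have m1 := hf.1.aestronglyMeasurable
  have m2 := hg.1.aestronglyMeasurable
  have := G.holder m1 m2
  refine ⟨⟨m1.mul m2, this.trans_lt (ENNReal.mul_lt_top hf.2 hg.2)⟩, le_trans ?_ this⟩
  rw [← Real.norm_eq_abs, ofReal_norm]
  exact enorm_integral_le_lintegral_enorm _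

theorem Good.nsmul (G : Good n N N') (c : ℝ≥0∞) {f : (Fin n → ℝ) → ℝ≥0∞}
    (hf : Measurable f) {g : (Fin n → ℝ) → ℝ≥0∞} (h : ∀ x, g x ≤ c * f x) : N g ≤ c * N f := by
  rw [← G.nm.smul c f hf]
  exact G.nm.mono _ _ (Eventually.of_forall h)

structure Fnl (N : ((Fin n → ℝ) → ℝ≥0∞) → ℝ≥0∞) (T : ((Fin n → ℝ) → ℝ) → ℝ) (M : ℝ) : Prop where
  add : ∀ f g, MD N f → MD N g → T (f + g) = T f + T g
  smul : ∀ (c : ℝ) f, MD N f → T (c • f) = c * T f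
  bd : ∀ f, MD N f → |T f| ≤ M * (N (fun x => ‖f x‖ₑ)).toReal
  nn : 0 ≤ M

structure Wt (N : ((Fin n → ℝ) → ℝ≥0∞) → ℝ≥0∞) (w : (Fin n → ℝ) → ℝ) : Prop where
  meas : Measurable w
  pos : ∀ x, 0 < w x
  le : ∀ x, w x ≤ 1
  fin : N (fun x => ‖w x‖ₑ) < ∞

theorem Good.wt (G : Good n N N') : ∃ w, Wt N w := by
  obtain ⟨w, h1, h2, h3, h4⟩ := G.fc.pos
  have ht : ∀ x, w x ≠ ∞ := fun x => ((h3 x).trans_lt ENNReal.one_lt_top).ne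
  refine ⟨fun x => (w x).toReal, h1.ennreal_toReal, fun x => ENNReal.toReal_pos (h2 x).ne' (ht x),
    fun x => ENNReal.toReal_le_of_le_ofReal zero_le_one (by simpa using h3 x), ?_⟩
  convert h4 using 3 with x
  rw [Real.enorm_of_nonneg ENNReal.toReal_nonneg, ENNReal.ofReal_toReal (ht x)]

theorem Wt.md {w : (Fin n → ℝ) → ℝ} (G : Good n N N') (W : Wt N w) {φ : (Fin n → ℝ) → ℝ}
    (hφ : Measurable φ) (C : ℝ) (hC : ∀ x, ‖φ x‖ ≤ C) : MD N (fun x => w x * φ x) := by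
  refine G.loc (W.meas.mul hφ).aestronglyMeasurable ?_
  refine lt_of_le_of_lt (G.nsmul (ENNReal.ofReal C) W.meas.enorm fun x => ?_)
    (ENNReal.mul_lt_top ENNReal.ofReal_lt_top W.fin)
  rw [enorm_mul, mul_comm]
  gcongr
  rw [← ofReal_norm]
  exact ENNReal.ofReal_le_ofReal (hC x)

theorem Wt.ind {w : (Fin n → ℝ) → ℝ} (G : Good n N N') (W : Wt N w) {E : Set (Fin n → ℝ)}
    (hE : MeasurableSet E) : MD N (E.indicator w) := by
  have := W.md G (φ := E.indicator 1) (measurable_one.indicator hE) 1 (fun x => by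
    by_cases h : x ∈ E <;> simp [h])
  convert this using 1
  funext x
  by_cases h : x ∈ E <;> simp [h]

theorem Fnl.zero {T : ((Fin n → ℝ) → ℝ) → ℝ} {M : ℝ} (G : Good n N N') (H : Fnl N T M)
    {f : (Fin n → ℝ) → ℝ} (hf : f =ᵐ[volume] 0) : MD N f ∧ T f = 0 := by
  have h0 : N (fun _ => 0) = 0 := by
    have := G.nm.smul 0 (fun _ => 0) measurable_const
    simpa using this
  have h1 : N (fun x => ‖f x‖ₑ) = 0 := by
    rw [← h0]
    refine G.nm.congr ?_
    filter_upwards [hf] with x hx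
    simp [hx]
  have hm : MD N f := G.loc (aestronglyMeasurable_const (b := (0:ℝ)).congr hf.symm) (by simp [h1])
  refine ⟨hm, ?_⟩
  have := H.bd f hm
  rw [h1] at this
  simpa using this

theorem Fnl.congr {T : ((Fin n → ℝ) → ℝ) → ℝ} {M : ℝ} (G : Good n N N') (H : Fnl N T M)
    {f g : (Fin n → ℝ) → ℝ} (hf : f =ᵐ[volume] g) (hm : MD N f) : MD N g ∧ T f = T g := by
  have h1 : (g - f) =ᵐ[volume] 0 := by
    filter_upwards [hf] with x hx
    simp [hx]
  obtain ⟨a, b⟩ := H.zero G h1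
  have h2 := H.add f (g - f) hm a
  rw [b, add_zero, add_sub_cancel] at h2
  refine ⟨?_, h2.symm⟩
  refine G.loc (hm.1.aestronglyMeasurable.congr hf) ?_
  rw [← G.nm.congr (f := fun x => ‖f x‖ₑ)]
  · exact hm.2
  · filter_upwards [hf] with x hx
    rw [hx]

theorem Fnl.union {T : ((Fin n → ℝ) → ℝ) → ℝ} {M : ℝ} {w : (Fin n → ℝ) → ℝ}
    (G : Good n N N') (H : Fnl N T M)
    (W : Wt N w) {A B : Set (Fin n → ℝ)} (hA : MeasurableSet A) (hB : MeasurableSet B)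
    (hd : Disjoint A B) : T ((A ∪ B).indicator w) = T (A.indicator w) + T (B.indicator w) := by
  rw [← H.add _ _ (W.ind G hA) (W.ind G hB), Set.indicator_union_of_disjoint hd]
  rfl

theorem Fnl.fin_union {T : ((Fin n → ℝ) → ℝ) → ℝ} {M : ℝ} {w : (Fin n → ℝ) → ℝ}
    (G : Good n N N') (H : Fnl N T M)
    (W : Wt N w) (A : ℕ → Set (Fin n → ℝ)) (hA : ∀ i, MeasurableSet (A i))
    (hd : Pairwise (Disjoint on A)) (s : Finset ℕ) :
    T ((⋃ i ∈ s, A i).indicator w) = ∑ i ∈ s, T ((A i).indicator w) := by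
  classical
  induction s using Finset.induction_on with
  | empty =>
    simp only [Finset.notMem_empty, Set.iUnion_of_empty, Set.iUnion_empty, Finset.sum_empty]
    exact (H.zero G (by rw [Set.indicator_empty'])).2
  | insert a s ha ih =>
    rw [Finset.set_biUnion_insert, H.union G W (hA a) (Finset.measurableSet_biUnion _ fun i _ => hA i),
      ih, Finset.sum_insert ha]
    rw [Set.disjoint_iUnion₂_right]
    intro i hi
    exact hd (fun e => ha (e ▸ hi))

theorem Fnl.hasSum {T : ((Fin n → ℝ) → ℝ) → ℝ} {M : ℝ} {w : (Fin n → ℝ) → ℝ}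
    (G : Good n N N') (H : Fnl N T M)
    (W : Wt N w) (A : ℕ → Set (Fin n → ℝ)) (hA : ∀ i, MeasurableSet (A i))
    (hd : Pairwise (Disjoint on A)) :
    HasSum (fun i => T ((A i).indicator w)) (T ((⋃ i, A i).indicator w)) := by
  set U := ⋃ i, A i with hU
  have mU : MeasurableSet U := MeasurableSet.iUnion hA
  have mS : ∀ s : Finset ℕ, MeasurableSet (⋃ i ∈ s, A i) := fun s =>
    Finset.measurableSet_biUnion _ fun i _ => hA i
  have sub : ∀ s : Finset ℕ, (⋃ i ∈ s, A i) ⊆ U := fun s => by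
    intro x hx
    simp only [Set.mem_iUnion] at hx
    obtain ⟨i, _, hi⟩ := hx
    exact Set.mem_iUnion.2 ⟨i, hi⟩
  let R : Finset ℕ → Set (Fin n → ℝ) := fun s => U \ ⋃ i ∈ s, A i
  have mR : ∀ s, MeasurableSet (R s) := fun s => mU.diff (mS s)
  have hT : ∀ s : Finset ℕ, T (U.indicator w) = ∑ i ∈ s, T ((A i).indicator w) +
      T ((R s).indicator w) := by
    intro s
    rw [← H.fin_union G W A hA hd, ← H.union G W (mS s) (mR s) Set.disjoint_sdiff_right,
      Set.union_sdiff_cancel (sub s)]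
  have htend : Tendsto (fun m => N (fun x => ‖(R (Finset.range m)).indicator w x‖ₑ)) atTop (𝓝 0) := by
    refine G.fc.oc _ (fun x => ‖w x‖ₑ) (fun m => (W.meas.indicator (mR _)).enorm) W.meas.enorm
      W.fin (Eventually.of_forall fun x m => ?_) (Eventually.of_forall fun x => ?_)
    · by_cases h : x ∈ R (Finset.range m) <;> simp [h]
    · refine tendsto_const_nhds.congr' ?_
      by_cases hx : x ∈ U
      · obtain ⟨i, hi⟩ := Set.mem_iUnion.1 hx
        filter_upwards [eventually_gt_atTop i] with m hm
        have : x ∉ R (Finset.range m) := by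
          intro h
          refine h.2 ?_
          simp only [Set.mem_iUnion]
          exact ⟨i, Finset.mem_range.2 hm, hi⟩
        simp [this]
      · refine Eventually.of_forall fun m => ?_
        have : x ∉ R (Finset.range m) := fun h => hx h.1
        simp [this]
  have hanti : ∀ m (s : Finset ℕ), Finset.range m ⊆ s →
      N (fun x => ‖(R s).indicator w x‖ₑ) ≤ N (fun x => ‖(R (Finset.range m)).indicator w x‖ₑ) := by
    intro m s hs
    refine G.nm.mono _ _ (Eventually.of_forall fun x => ?_)
    by_cases h : x ∈ R s
    · have : x ∈ R (Finset.range m) := by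
        refine ⟨h.1, fun h' => h.2 ?_⟩
        simp only [Set.mem_iUnion] at h' ⊢
        obtain ⟨i, h1, h2⟩ := h'
        exact ⟨i, hs h1, h2⟩
      simp [h, this]
    · simp [h]
  have hfin : ∀ s, N (fun x => ‖(R s).indicator w x‖ₑ) ≠ ∞ := fun s => (W.ind G (mR s)).2.ne
  have ht2 : Tendsto (fun m => M * (N (fun x => ‖(R (Finset.range m)).indicator w x‖ₑ)).toReal)
      atTop (𝓝 0) := by
    have := ((ENNReal.tendsto_toReal ENNReal.zero_ne_top).comp htend).const_mul M
    simpa using this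
  unfold HasSum
  rw [SummationFilter.unconditional_filter, Metric.tendsto_atTop]
  intro ε hε
  obtain ⟨m, hm⟩ := ((tendsto_order.1 ht2).2 ε hε).exists
  refine ⟨Finset.range m, fun s hs => ?_⟩
  rw [dist_comm, Real.dist_eq, hT s, add_sub_cancel_left]
  refine lt_of_le_of_lt (H.bd _ (W.ind G (mR s))) (lt_of_le_of_lt ?_ hm)
  refine mul_le_mul_of_nonneg_left ?_ H.nn
  exact ENNReal.toReal_mono (hfin _) (hanti m s hs)

theorem Fnl.rep {T : ((Fin n → ℝ) → ℝ) → ℝ} {M : ℝ} {w : (Fin n → ℝ) → ℝ}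
    (G : Good n N N') (H : Fnl N T M) (W : Wt N w) :
    ∃ h : (Fin n → ℝ) → ℝ, Measurable h ∧ Integrable h volume ∧
      ∀ E, MeasurableSet E → T (E.indicator w) = ∫ x in E, h x := by
  classical
  let ν : SignedMeasure (Fin n → ℝ) :=
    { measureOf' := fun E => if MeasurableSet E then T (E.indicator w) else 0
      empty' := by
        rw [if_pos MeasurableSet.empty]
        exact (H.zero G (by rw [Set.indicator_empty'])).2
      not_measurable' := fun E hE => if_neg hE
      m_iUnion' := by
        intro A hA hd
        simp only [hA, MeasurableSet.iUnion hA, if_true]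
        exact H.hasSum G W A hA hd }
  have hν : ∀ E, MeasurableSet E → ν E = T (E.indicator w) := fun E hE => if_pos hE
  have hac : VectorMeasure.AbsolutelyContinuous ν
      (volume : Measure (Fin n → ℝ)).toENNRealVectorMeasure := by
    refine VectorMeasure.AbsolutelyContinuous.mk fun E hE h0 => ?_
    rw [Measure.toENNRealVectorMeasure_apply_measurable hE] at h0
    rw [hν E hE]
    refine (H.zero G ?_).2
    have := measure_eq_zero_iff_ae_notMem.1 h0
    filter_upwards [this] with x hx
    simp [hx]
  have := (SignedMeasure.absolutelyContinuous_iff_withDensityᵥ_rnDeriv_eq ν volume).1 hac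
  refine ⟨ν.rnDeriv volume, SignedMeasure.measurable_rnDeriv _ _, SignedMeasure.integrable_rnDeriv _ _, ?_⟩
  intro E hE
  rw [← hν E hE, ← withDensityᵥ_apply (SignedMeasure.integrable_rnDeriv _ _) hE, this]

theorem Wt.mdS {w : (Fin n → ℝ) → ℝ} (G : Good n N N') (W : Wt N w)
    (φ : SimpleFunc (Fin n → ℝ) ℝ) : MD N (fun x => w x * φ x) := by
  obtain ⟨C, hC⟩ := φ.exists_forall_norm_le
  exact W.md G φ.measurable C hC

theorem simple_int {h : (Fin n → ℝ) → ℝ} (hh : Integrable h volume)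
    (φ : SimpleFunc (Fin n → ℝ) ℝ) : Integrable (fun x => φ x * h x) volume := by
  obtain ⟨C, hC⟩ := φ.exists_forall_norm_le
  exact hh.bdd_mul φ.measurable.aestronglyMeasurable (Eventually.of_forall hC)

theorem Fnl.simple {T : ((Fin n → ℝ) → ℝ) → ℝ} {M : ℝ} {w : (Fin n → ℝ) → ℝ}
    (G : Good n N N') (H : Fnl N T M) (W : Wt N w) {h : (Fin n → ℝ) → ℝ}
    (hh : Integrable h volume)
    (hr : ∀ E, MeasurableSet E → T (E.indicator w) = ∫ x in E, h x)
    (φ : SimpleFunc (Fin n → ℝ) ℝ) : T (fun x => w x * φ x) = ∫ x, φ x * h x := by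
  induction φ using SimpleFunc.induction with
  | const c hs =>
    rename_i s
    have e1 : (fun x => w x * (SimpleFunc.piecewise s hs (SimpleFunc.const _ c)
        (SimpleFunc.const _ 0)) x) = c • s.indicator w := by
      funext x; by_cases hx : x ∈ s <;> simp [hx, mul_comm]
    have e2 : (fun x => (SimpleFunc.piecewise s hs (SimpleFunc.const _ c)
        (SimpleFunc.const _ 0)) x * h x) = s.indicator (fun x => c * h x) := by
      funext x; by_cases hx : x ∈ s <;> simp [hx]
    rw [e1, e2, H.smul _ _ (W.ind G hs), hr s hs, integral_indicator hs, integral_const_mul]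
  | add hd hf hg =>
    rename_i f g
    have e1 : (fun x => w x * (f + g) x) = (fun x => w x * f x) + (fun x => w x * g x) := by
      funext x; simp [mul_add]
    rw [e1, H.add _ _ (W.mdS G f) (W.mdS G g), hf, hg,
      ← integral_add (simple_int hh f) (simple_int hh g)]
    congr 1; funext x; simp [add_mul]


theorem Fnl.norm_le {T : ((Fin n → ℝ) → ℝ) → ℝ} {M : ℝ} {w : (Fin n → ℝ) → ℝ}
    (G : Good n N N') (H : Fnl N T M) (W : Wt N w) {h : (Fin n → ℝ) → ℝ}
    (hm : Measurable h) (hh : Integrable h volume)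
    (hr : ∀ E, MeasurableSet E → T (E.indicator w) = ∫ x in E, h x) :
    N' (fun x => ‖h x / w x‖ₑ) ≤
      ⨆ (f : (Fin n → ℝ) → ℝ) (_ : MD N f ∧ N (fun x => ‖f x‖ₑ) ≤ 1), ENNReal.ofReal |T f| := by
  have hgm : Measurable fun x => ‖h x / w x‖ₑ := (hm.div W.meas).enorm
  obtain ⟨F, hF, hN, hs⟩ := G.du.ext (Z := Unit) (fun _ x => ‖h x / w x‖ₑ)
    (hgm.comp measurable_snd)
  refine (hs ()).trans (iSup_le fun j => ?_)
  have hFm : Measurable (F j ()) := (hF j).comp measurable_prodMk_left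
  have hNj := hN j ()
  generalize F j () = f at hFm hNj
  have w0 : ∀ x, ‖w x‖ₑ ≠ 0 := fun x => by simpa using (W.pos x).ne'
  have w1 : ∀ x, ‖w x‖ₑ ≠ ∞ := fun x => enorm_ne_top
  let u : (Fin n → ℝ) → ℝ≥0∞ := fun x => f x / ‖w x‖ₑ
  have hu : Measurable u := hFm.div W.meas.enorm
  have huw : ∀ x, u x * ‖w x‖ₑ = f x := fun x => ENNReal.div_mul_cancel (w0 x) (w1 x)
  have e1 : ∀ x, f x * ‖h x / w x‖ₑ = ⨆ m, SimpleFunc.eapprox u m x * ‖h x‖ₑ := by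
    intro x
    rw [← ENNReal.iSup_mul, SimpleFunc.iSup_eapprox_apply hu, ← huw x, mul_assoc, ← enorm_mul,
      mul_div_cancel₀ _ (W.pos x).ne']
  simp only [e1]
  rw [lintegral_iSup (f := fun m x => SimpleFunc.eapprox u m x * ‖h x‖ₑ) (fun m => (SimpleFunc.eapprox u m).measurable.mul hm.enorm) (by
    intro a b hab x
    exact mul_le_mul_left (SimpleFunc.monotone_eapprox u hab x) _)]
  refine iSup_le fun m => ?_
  let sg : SimpleFunc (Fin n → ℝ) ℝ := SimpleFunc.piecewise {x | 0 ≤ h x}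
    (measurableSet_le measurable_const hm) (SimpleFunc.const _ 1) (SimpleFunc.const _ (-1))
  have hsg : ∀ x, sg x * h x = |h x| := by
    intro x
    by_cases hx : 0 ≤ h x
    · have : sg x = 1 := by simp [sg, SimpleFunc.piecewise_apply, hx]
      rw [this, abs_of_nonneg hx, one_mul]
    · have : sg x = -1 := by simp [sg, SimpleFunc.piecewise_apply, hx]
      rw [this, abs_of_neg (not_le.1 hx), neg_one_mul]
  have hsg1 : ∀ x, ‖sg x‖ₑ = 1 := by
    intro x
    by_cases hx : 0 ≤ h x <;> simp [sg, SimpleFunc.piecewise_apply, hx]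
  let φ : SimpleFunc (Fin n → ℝ) ℝ := (SimpleFunc.eapprox u m).map ENNReal.toReal
  have hφ : ∀ x, φ x = (SimpleFunc.eapprox u m x).toReal := fun x => rfl
  have hφe : ∀ x, ENNReal.ofReal (φ x) = SimpleFunc.eapprox u m x := fun x => by
    rw [hφ, ENNReal.ofReal_toReal (SimpleFunc.eapprox_lt_top u m x).ne]
  have hφ0 : ∀ x, 0 ≤ φ x := fun x => ENNReal.toReal_nonneg
  have hT := H.simple G W hh hr (φ * sg)
  have e2 : ∀ x, (φ * sg) x * h x = φ x * |h x| := by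
    intro x
    rw [SimpleFunc.mul_apply, mul_assoc, hsg]
  have hI := simple_int hh (φ * sg)
  simp only [e2] at hT hI
  have e3 : ∫⁻ x, SimpleFunc.eapprox u m x * ‖h x‖ₑ =
      ENNReal.ofReal (T fun x => w x * (φ * sg) x) := by
    rw [hT, ofReal_integral_eq_lintegral_ofReal hI
      (Eventually.of_forall fun x => mul_nonneg (hφ0 x) (abs_nonneg _))]
    refine lintegral_congr fun x => ?_
    rw [ENNReal.ofReal_mul (hφ0 x), hφe, ← Real.norm_eq_abs, ofReal_norm]
  rw [e3]
  refine le_trans (ENNReal.ofReal_le_ofReal (le_abs_self _)) ?_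
  refine le_iSup₂_of_le (fun x => w x * (φ * sg) x) ⟨W.mdS G _, ?_⟩ le_rfl
  refine le_trans (G.nm.mono _ _ (Eventually.of_forall fun x => ?_)) hNj
  show ‖w x * (φ * sg) x‖ₑ ≤ f x
  rw [SimpleFunc.mul_apply, enorm_mul, enorm_mul, hsg1, mul_one, Real.enorm_of_nonneg (hφ0 x), hφe,
    ← huw x, mul_comm]
  gcongr
  rw [← SimpleFunc.iSup_eapprox_apply hu]
  exact le_iSup (fun m => SimpleFunc.eapprox u m x) m

theorem Fnl.eq {T : ((Fin n → ℝ) → ℝ) → ℝ} {M : ℝ} {w : (Fin n → ℝ) → ℝ}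
    (G : Good n N N') (H : Fnl N T M) (W : Wt N w) {h : (Fin n → ℝ) → ℝ}
    (hh : Integrable h volume)
    (hr : ∀ E, MeasurableSet E → T (E.indicator w) = ∫ x in E, h x)
    (hg : MD N' fun x => h x / w x) {f : (Fin n → ℝ) → ℝ} (hf : MD N f) :
    T f = ∫ x, f x * (h x / w x) := by
  -- reduce to measurable
  wlog hfm : Measurable f generalizing f with key
  · have e := hf.1.aestronglyMeasurable.ae_eq_mk
    obtain ⟨a, b⟩ := H.congr G e hf
    rw [b, key a hf.1.aestronglyMeasurable.stronglyMeasurable_mk.measurable]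
    refine integral_congr_ae ?_
    filter_upwards [e] with x hx
    rw [← hx]
  let q : (Fin n → ℝ) → ℝ := fun x => f x / w x
  have hq : Measurable q := hfm.div W.meas
  have hwq : ∀ x, w x * q x = f x := fun x => mul_div_cancel₀ _ (W.pos x).ne'
  let ψ : ℕ → SimpleFunc (Fin n → ℝ) ℝ := fun m =>
    SimpleFunc.approxOn q hq Set.univ 0 (Set.mem_univ _) m
  have hψ1 : ∀ m x, ‖ψ m x‖ ≤ ‖q x‖ + ‖q x‖ := fun m x =>
    SimpleFunc.norm_approxOn_zero_le hq (Set.mem_univ _) x m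
  have hψ2 : ∀ x, Tendsto (fun m => ψ m x) atTop (𝓝 (q x)) := fun x =>
    SimpleFunc.tendsto_approxOn hq (Set.mem_univ _) (by simp)
  let r : ℕ → (Fin n → ℝ) → ℝ := fun m x => f x - w x * ψ m x
  have hrm : ∀ m, Measurable (r m) := fun m => hfm.sub (W.meas.mul (ψ m).measurable)
  have hrle : ∀ m x, ‖r m x‖ₑ ≤ 3 * ‖f x‖ₑ := by
    intro m x
    have h1 : ‖r m x‖ ≤ 3 * ‖f x‖ := by
      have e : r m x = w x * (q x - ψ m x) := by simp only [r, mul_sub, hwq]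
      have e2 : ‖f x‖ = w x * ‖q x‖ := by
        rw [← hwq x, norm_mul, Real.norm_of_nonneg (W.pos x).le]
      rw [e, norm_mul, Real.norm_of_nonneg (W.pos x).le, e2]
      have := norm_sub_le (q x) (ψ m x)
      have h3 : ‖q x - ψ m x‖ ≤ 3 * ‖q x‖ := by linarith [hψ1 m x]
      nlinarith [mul_le_mul_of_nonneg_left h3 (W.pos x).le]
    rw [← ofReal_norm, ← ofReal_norm (f x)]
    refine (ENNReal.ofReal_le_ofReal h1).trans (le_of_eq ?_)
    rw [ENNReal.ofReal_mul (by norm_num)]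
    simp
  have h3f : N (fun x => 3 * ‖f x‖ₑ) < ∞ := by
    rw [G.nm.smul _ _ hfm.enorm]
    exact ENNReal.mul_lt_top (by simp) hf.2
  have hr0 : Tendsto (fun m => N (fun x => ‖r m x‖ₑ)) atTop (𝓝 0) := by
    refine G.fc.oc _ (fun x => 3 * ‖f x‖ₑ) (fun m => (hrm m).enorm) (hfm.enorm.const_mul _) h3f
      (Eventually.of_forall fun x m => hrle m x) (Eventually.of_forall fun x => ?_)
    have h1 : Tendsto (fun m => r m x) atTop (𝓝 0) := by
      have := ((hψ2 x).const_mul (w x)).const_sub (f x)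
      rwa [hwq, sub_self] at this
    have := h1.enorm
    simpa using this
  have hrmd : ∀ m, MD N (r m) := fun m => G.loc (hrm m).aestronglyMeasurable
    ((G.nm.mono _ _ (Eventually.of_forall fun x => hrle m x)).trans_lt h3f)
  have hd : ∀ m, |T f - ∫ x, f x * (h x / w x)| ≤
      (M + (N' fun x => ‖h x / w x‖ₑ).toReal) * (N (fun x => ‖r m x‖ₑ)).toReal := by
    intro m
    have hs := W.mdS G (ψ m)
    have e1 : T f = T (r m) + T (fun x => w x * ψ m x) := by
      rw [← H.add _ _ (hrmd m) hs]
      congr 1; funext x; simp [r]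
    have c1 := G.conv (hrmd m) hg
    have c2 := G.conv hs hg
    have e2 : ∫ x, f x * (h x / w x) = (∫ x, r m x * (h x / w x)) + ∫ x, ψ m x * h x := by
      have e4 : ∫ x, ψ m x * h x = ∫ x, (w x * ψ m x) * (h x / w x) := by
        congr 1; funext x
        have := (W.pos x).ne'
        field_simp
      rw [e4, ← integral_add c1.1 c2.1]
      congr 1; funext x; simp only [r]; ring
    rw [e1, e2, H.simple G W hh hr (ψ m), add_sub_add_right_eq_sub]
    have b1 := H.bd _ (hrmd m)
    have b2 := ENNReal.toReal_mono (ENNReal.mul_lt_top (hrmd m).2 hg.2).ne c1.2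
    rw [ENNReal.toReal_ofReal (abs_nonneg _), ENNReal.toReal_mul] at b2
    have := abs_sub (T (r m)) (∫ x, r m x * (h x / w x))
    nlinarith
  have hlim : Tendsto (fun m => (M + (N' fun x => ‖h x / w x‖ₑ).toReal) *
      (N (fun x => ‖r m x‖ₑ)).toReal) atTop (𝓝 0) := by
    have := ((ENNReal.tendsto_toReal ENNReal.zero_ne_top).comp hr0).const_mul
      (M + (N' fun x => ‖h x / w x‖ₑ).toReal)
    simpa using this
  have := ge_of_tendsto' hlim hd
  have := abs_eq_zero.1 (le_antisymm this (abs_nonneg _))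
  linarith

theorem Good.uniq {w : (Fin n → ℝ) → ℝ} (G : Good n N N') (W : Wt N w) {g g₂ : (Fin n → ℝ) → ℝ}
    (hg : MD N' g) (hg₂ : MD N' g₂)
    (he : ∀ f, MD N f → ∫ x, f x * g x = ∫ x, f x * g₂ x) : g₂ =ᵐ[volume] g := by
  have hw : MD N w := by simpa using W.ind G MeasurableSet.univ
  have i1 := (G.conv hw hg).1
  have i2 := (G.conv hw hg₂).1
  have := (i1.sub i2).ae_eq_zero_of_forall_setIntegral_eq_zero (fun E hE _ => by
    have h1 := he _ (W.ind G hE)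
    have aux : ∀ k : (Fin n → ℝ) → ℝ, ∫ x, E.indicator w x * k x = ∫ x in E, w x * k x := by
      intro k
      rw [← integral_indicator hE]
      congr 1; funext x; by_cases hx : x ∈ E <;> simp [hx]
    rw [aux, aux] at h1
    simp only [Pi.sub_apply]
    rw [integral_sub i1.integrableOn i2.integrableOn, h1, sub_self])
  filter_upwards [this] with x hx
  have hp := (W.pos x).ne'
  simp only [Pi.sub_apply, Pi.zero_apply, ← mul_sub] at hx
  rcases mul_eq_zero.1 hx with h | h
  · exact absurd h hp
  · linarith

theorem Good.main (G : Good n N N') (T : ((Fin n → ℝ) → ℝ) → ℝ)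
    (hadd : ∀ f g, MD N f → MD N g → T (f + g) = T f + T g)
    (hsmul : ∀ (c : ℝ) f, MD N f → T (c • f) = c * T f)
    (hbd : ∃ M : ℝ, ∀ f, MD N f → |T f| ≤ M * (N fun x => ‖f x‖ₑ).toReal) :
    ∃ g : (Fin n → ℝ) → ℝ, MD N' g ∧
        (∀ f, MD N f →
          Integrable (fun x => f x * g x) volume ∧ T f = ∫ x, f x * g x) ∧
        (∀ g₂, MD N' g₂ →
          (∀ f, MD N f → T f = ∫ x, f x * g₂ x) → g₂ =ᵐ[volume] g) ∧
        N' (fun x => ‖g x‖ₑ) =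
          ⨆ (f : (Fin n → ℝ) → ℝ) (_ : MD N f ∧ N (fun x => ‖f x‖ₑ) ≤ 1),
            ENNReal.ofReal |T f| := by
  obtain ⟨M, hM⟩ := hbd
  have H : Fnl N T |M| := ⟨hadd, hsmul, fun f hf => (hM f hf).trans
    (mul_le_mul_of_nonneg_right (le_abs_self _) ENNReal.toReal_nonneg), abs_nonneg _⟩
  obtain ⟨w, W⟩ := G.wt
  obtain ⟨h, hm, hh, hr⟩ := H.rep G W
  have hle := H.norm_le G W hm hh hr
  have hsup : (⨆ (f : (Fin n → ℝ) → ℝ) (_ : MD N f ∧ N (fun x => ‖f x‖ₑ) ≤ 1),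
      ENNReal.ofReal |T f|) ≤ ENNReal.ofReal |M| := by
    refine iSup₂_le fun f hf => ENNReal.ofReal_le_ofReal ((H.bd f hf.1).trans ?_)
    refine mul_le_of_le_one_right (abs_nonneg _) ?_
    exact ENNReal.toReal_le_of_le_ofReal zero_le_one (by simpa using hf.2)
  have hg : MD N' fun x => h x / w x := G.loc' (hm.div W.meas).aestronglyMeasurable
    ((hle.trans hsup).trans_lt ENNReal.ofReal_lt_top)
  have hT : ∀ f, MD N f → T f = ∫ x, f x * (h x / w x) := fun f hf => H.eq G W hh hr hg hf
  refine ⟨fun x => h x / w x, hg, fun f hf => ⟨(G.conv hf hg).1, hT f hf⟩, ?_, le_antisymm hle ?_⟩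
  · intro g₂ hg₂ h2
    exact G.uniq W hg hg₂ fun f hf => by rw [← hT f hf, h2 f hf]
  · refine iSup₂_le fun f hf => ?_
    rw [hT f hf.1]
    refine (G.conv hf.1 hg).2.trans ?_
    exact mul_le_of_le_one_left (zero_le) hf.2

end abs

end Helpers

/-- The dual of `(L^{p⃗},ℓ^{s⃗})(ℝⁿ)` is isometrically isomorphic
to `(L^{p⃗'},ℓ^{s⃗'})(ℝⁿ)`: every bounded linear functional is represented by a
unique `g ∈ (L^{p⃗'},ℓ^{s⃗'})` via integration, with equality of norms, and
conversely every such `g` gives a bounded functional. -/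
theorem statement8 (n : ℕ) (hn : 1 ≤ n) (p s p' s' : Fin n → ℝ≥0∞)
    (hp : ∀ i, 1 ≤ p i ∧ p i ≠ ∞) (hs : ∀ i, 1 ≤ s i ∧ s i ≠ ∞)
    (hp' : ∀ i, 1 / p i + 1 / p' i = 1) (hs' : ∀ i, 1 / s i + 1 / s' i = 1) :
    (∀ T : ((Fin n → ℝ) → ℝ) → ℝ,
      (∀ f g, memD n p s f → memD n p s g → T (f + g) = T f + T g) →
      (∀ (c : ℝ) f, memD n p s f → T (c • f) = c * T f) →
      (∃ M : ℝ, ∀ f, memD n p s f → |T f| ≤ M * (discNorm n p s f).toReal) →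
      ∃ g : (Fin n → ℝ) → ℝ, memD n p' s' g ∧
        (∀ f, memD n p s f →
          Integrable (fun x => f x * g x) volume ∧ T f = ∫ x, f x * g x) ∧
        (∀ g₂, memD n p' s' g₂ →
          (∀ f, memD n p s f → T f = ∫ x, f x * g₂ x) → g₂ =ᵐ[volume] g) ∧
        discNorm n p' s' g =
          ⨆ (f : (Fin n → ℝ) → ℝ) (_ : memD n p s f ∧ discNorm n p s f ≤ 1),
            ENNReal.ofReal |T f|) ∧
    (∀ g : (Fin n → ℝ) → ℝ, memD n p' s' g → ∀ f, memD n p s f →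
      Integrable (fun x => f x * g x) volume ∧
      ENNReal.ofReal |∫ x, f x * g x| ≤ discNorm n p s f * discNorm n p' s' g) := by
  have e : ∀ p s f, memD n p s f ↔ MD (DN n p s) f := by
    intro p s f
    unfold memD MD
    rw [discNorm_eq]
  have G := DN_good n p s p' s' hp hs hp' hs'
  simp only [e, discNorm_eq]
  exact ⟨fun T h1 h2 h3 => G.main T h1 h2 h3, fun g hg f hf => G.conv hf hg⟩

end MixedAmalgam

end
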